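/- arXiv:1908.09671 — 13 statements merged into one kernel-verified Lean document; each statement's English description precedes it below -/
import Mathlib

section
/- The lattice polytope P of the secant of the Segre–Veronese variety equals the polyhedron cut out by its defining inequalities: P = { x : I → ℝ | (∀ p ∈ I, 0 ≤ x p) ∧ (∀ i : Fin k, ∑ j, x ⟨i,j⟩ ≤ a i) ∧ 2 ≤ ∑ p, x p }. In other words, the convex hull of the integer points of S coincides with the set of all real solutions of the inequalities x ≥ 0, ∑_{j} x_{i,j} ≤ a_i for every i, and ∑_{i,j} x_{i,j} ≥ 2 (this is the facet/inequality description of the cone C_P in the paper's normality lemma, restricted to height 1). -/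
open Finset

/-- The polyhedron of nonnegative `x` whose block sums are at most `a i` and whose total is at
least `m`. -/
def blockPolyhedron {k : ℕ} (a b : Fin k → ℕ) (m : ℕ) : Set ((Σ i : Fin k, Fin (b i)) → ℝ) :=
  {x | (∀ p, 0 ≤ x p) ∧ (∀ i : Fin k, ∑ j, x ⟨i, j⟩ ≤ (a i : ℝ)) ∧ (m : ℝ) ≤ ∑ p, x p}

theorem eventually_nonneg_add_mul {α β : ℝ} (hα : 0 ≤ α) (h : β ≠ 0 → 0 < α) :
    ∀ᶠ ε in nhds (0 : ℝ), 0 ≤ α + ε * β := by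
  by_cases hβ : β = 0
  · simp [hβ, hα]
  · have hc : ContinuousAt (fun ε : ℝ => α + ε * β) 0 := by fun_prop
    have h0 : 0 < (fun ε : ℝ => α + ε * β) 0 := by simpa using h hβ
    exact (hc.eventually (lt_mem_nhds h0)).mono fun _ h => h.le

/-- The real numbers that are integers. -/
abbrev integerReals : AddSubgroup ℝ := (Int.castAddHom ℝ).range

theorem natCast_mem_integerReals (n : ℕ) : (n : ℝ) ∈ integerReals := ⟨n, by simp⟩

theorem sum_notMem_of_unique {ι G : Type*} [Fintype ι] [AddCommGroup G]
    (H : AddSubgroup G) (f : ι → G) (p : ι) (hp : f p ∉ H)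
    (h : ∀ q, f q ∉ H → q = p) : ∑ q, f q ∉ H := by
  classical
  rw [← Finset.add_sum_erase _ _ (Finset.mem_univ p)]
  intro hmem
  refine hp ((H.add_mem_cancel_right (H.sum_mem fun q hq => ?_)).1 hmem)
  by_contra hq'
  exact (Finset.mem_erase.1 hq).1 (h q hq')

theorem sum_single_block {k : ℕ} {b : Fin k → ℕ} (p : Σ i : Fin k, Fin (b i)) (i : Fin k) :
    ∑ j, (Pi.single p 1 : (Σ i : Fin k, Fin (b i)) → ℝ) ⟨i, j⟩ = if i = p.1 then 1 else 0 := by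
  obtain ⟨i', j'⟩ := p
  split_ifs with h
  · subst h
    simp [Pi.single_apply]
  · refine Finset.sum_eq_zero fun j _ => Pi.single_eq_of_ne (fun hj => h ?_) _
    exact congrArg Sigma.fst hj

section

variable {k : ℕ} {a b : Fin k → ℕ} {m : ℕ} {x : (Σ i : Fin k, Fin (b i)) → ℝ}

/-- Along a direction that leaves every tight constraint unchanged, one can move a little from a
point of the polyhedron. -/
theorem blockPolyhedron_eventually_add_smul_mem (hx : x ∈ blockPolyhedron a b m)
    (v : (Σ i : Fin k, Fin (b i)) → ℝ) (h1 : ∀ p, v p ≠ 0 → 0 < x p)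
    (h2 : ∀ i, ∑ j, v ⟨i, j⟩ ≠ 0 → ∑ j, x ⟨i, j⟩ < (a i : ℝ))
    (h3 : ∑ p, v p ≠ 0 → (m : ℝ) < ∑ p, x p) :
    ∀ᶠ ε in nhds (0 : ℝ), x + ε • v ∈ blockPolyhedron a b m := by
  obtain ⟨hx1, hx2, hx3⟩ := hx
  have e1 := Filter.eventually_all.2 fun p => eventually_nonneg_add_mul (hx1 p) (h1 p)
  have e2 := Filter.eventually_all.2 fun i =>
    eventually_nonneg_add_mul (sub_nonneg.2 (hx2 i)) (β := -∑ j, v ⟨i, j⟩)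
      fun h => sub_pos.2 (h2 i (neg_ne_zero.1 h))
  have e3 := eventually_nonneg_add_mul (sub_nonneg.2 hx3) fun h => sub_pos.2 (h3 h)
  filter_upwards [e1, e2, e3] with ε e1 e2 e3
  refine ⟨fun p => by simpa using e1 p, fun i => ?_, ?_⟩
  · have := e2 i
    simp only [Pi.add_apply, Pi.smul_apply, smul_eq_mul, Finset.sum_add_distrib,
      ← Finset.mul_sum]
    linarith
  · simp only [Pi.add_apply, Pi.smul_apply, smul_eq_mul, Finset.sum_add_distrib,
      ← Finset.mul_sum]
    linarith

/-- At an extreme point, the only direction that leaves every tight constraint unchanged is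
zero. -/
theorem eq_zero_of_mem_extremePoints_blockPolyhedron
    (hx : x ∈ (blockPolyhedron a b m).extremePoints ℝ)
    (v : (Σ i : Fin k, Fin (b i)) → ℝ) (h1 : ∀ p, v p ≠ 0 → 0 < x p)
    (h2 : ∀ i, ∑ j, v ⟨i, j⟩ ≠ 0 → ∑ j, x ⟨i, j⟩ < (a i : ℝ))
    (h3 : ∑ p, v p ≠ 0 → (m : ℝ) < ∑ p, x p) : v = 0 := by
  have e := blockPolyhedron_eventually_add_smul_mem hx.1 v h1 h2 h3
  have e' : ∀ᶠ ε in nhds (0 : ℝ), x + (-ε) • v ∈ blockPolyhedron a b m := by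
    have ht : Filter.Tendsto (fun ε : ℝ => -ε) (nhds 0) (nhds 0) := by
      simpa using (continuous_neg (G := ℝ)).tendsto 0
    exact ht.eventually e
  obtain ⟨ε, ⟨hp, hn⟩, hε⟩ :=
    (((e.and e').filter_mono nhdsWithin_le_nhds).and
      (self_mem_nhdsWithin : Set.Ioi (0 : ℝ) ∈ nhdsWithin 0 (Set.Ioi 0))).exists
  have hseg : x ∈ openSegment ℝ (x + ε • v) (x + (-ε) • v) :=
    ⟨1 / 2, 1 / 2, by norm_num, by norm_num, by norm_num, by module⟩
  have hxv : ε • v = 0 := by simpa using hx.2 hp hn hseg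
  exact (smul_eq_zero.1 hxv).resolve_left (ne_of_gt hε)

theorem mem_integerReals_of_mem_extremePoints_blockPolyhedron
    (hx : x ∈ (blockPolyhedron a b m).extremePoints ℝ) (p : Σ i : Fin k, Fin (b i)) :
    x p ∈ integerReals := by
  obtain ⟨hx1, hx2, hx3⟩ := hx.1
  have hpos : ∀ q, x q ∉ integerReals → 0 < x q := fun q hq =>
    (hx1 q).lt_of_ne fun h => hq (h ▸ integerReals.zero_mem)
  have exchange : ∀ q r, x q ∉ integerReals → x r ∉ integerReals →
      (q.1 ≠ r.1 → ∑ j, x ⟨q.1, j⟩ < (a q.1 : ℝ) ∧ ∑ j, x ⟨r.1, j⟩ < (a r.1 : ℝ)) →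
      q = r := by
    intro q r hq hr hqr
    by_contra hne
    have hv := eq_zero_of_mem_extremePoints_blockPolyhedron hx
      (Pi.single q 1 - Pi.single r 1) ?_ ?_ ?_
    · simpa [hne] using congrFun hv q
    · intro s hs
      by_cases hsq : s = q
      · exact hsq ▸ hpos q hq
      · by_cases hsr : s = r
        · exact hsr ▸ hpos r hr
        · simp [hsq, hsr] at hs
    · intro i hi
      simp only [Pi.sub_apply, Finset.sum_sub_distrib, sum_single_block] at hi
      by_cases hiq : i = q.1
      · by_cases hir : i = r.1
        · simp [← hiq, ← hir] at hi
        · exact hiq ▸ (hqr (hiq ▸ hir)).1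
      · by_cases hir : i = r.1
        · exact hir ▸ (hqr fun h => hiq (hir.trans h.symm)).2
        · simp [hiq, hir] at hi
    · simp
  have hblock : ∀ q, x q ∉ integerReals → ∑ j, x ⟨q.1, j⟩ < (a q.1 : ℝ) := by
    intro q hq
    refine (hx2 q.1).lt_of_ne fun h => ?_
    refine sum_notMem_of_unique integerReals (fun j => x ⟨q.1, j⟩) q.2 hq (fun j hj => ?_)
      (h ▸ natCast_mem_integerReals _)
    exact eq_of_heq (Sigma.mk.inj (exchange ⟨q.1, j⟩ q hj hq fun h => absurd rfl h)).2
  by_contra hp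
  have htotal : (m : ℝ) < ∑ q, x q := by
    refine hx3.lt_of_ne fun h => ?_
    refine sum_notMem_of_unique integerReals x p hp (fun q hq => ?_)
      (h ▸ natCast_mem_integerReals _)
    exact exchange q p hq hp fun _ => ⟨hblock q hq, hblock p hp⟩
  have hv := eq_zero_of_mem_extremePoints_blockPolyhedron hx (Pi.single p 1) ?_ ?_
    fun _ => htotal
  · simp at hv
  · intro s hs
    by_cases hsp : s = p
    · exact hsp ▸ hpos p hp
    · simp [hsp] at hs
  · intro i hi
    by_cases hip : i = p.1
    · exact hip ▸ hblock p hp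
    · simp [sum_single_block, hip] at hi

theorem isClosed_blockPolyhedron : IsClosed (blockPolyhedron a b m) := by
  simp only [blockPolyhedron, Set.ofPred_and, Set.ofPred_forall]
  refine (isClosed_iInter fun p => isClosed_le ?_ ?_).inter
    ((isClosed_iInter fun i => isClosed_le ?_ ?_).inter (isClosed_le ?_ ?_)) <;> fun_prop

theorem convex_blockPolyhedron : Convex ℝ (blockPolyhedron a b m) := by
  rintro x ⟨hx1, hx2, hx3⟩ y ⟨hy1, hy2, hy3⟩ s t hs ht hst
  refine ⟨fun p => ?_, fun i => ?_, ?_⟩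
  · exact add_nonneg (mul_nonneg hs (hx1 p)) (mul_nonneg ht (hy1 p))
  · simp only [Pi.add_apply, Pi.smul_apply, smul_eq_mul, Finset.sum_add_distrib,
      ← Finset.mul_sum]
    exact convex_Iic (a i : ℝ) (hx2 i) (hy2 i) hs ht hst
  · simp only [Pi.add_apply, Pi.smul_apply, smul_eq_mul, Finset.sum_add_distrib,
      ← Finset.mul_sum]
    exact convex_Ici (m : ℝ) hx3 hy3 hs ht hst

theorem isCompact_blockPolyhedron : IsCompact (blockPolyhedron a b m) := by
  refine (isCompact_Icc (a := (0 : (Σ i : Fin k, Fin (b i)) → ℝ))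
    (b := fun p => (a p.1 : ℝ))).of_isClosed_subset isClosed_blockPolyhedron ?_
  rintro x ⟨hx1, hx2, -⟩
  refine ⟨hx1, fun p => le_trans ?_ (hx2 p.1)⟩
  exact Finset.single_le_sum (f := fun j => x ⟨p.1, j⟩) (fun j _ => hx1 _)
    (Finset.mem_univ p.2)

theorem finite_natPoints_blockPolyhedron :
    {c : (Σ i : Fin k, Fin (b i)) → ℕ | (∀ i, ∑ j, c ⟨i, j⟩ ≤ a i) ∧ m ≤ ∑ p, c p}.Finite := by
  refine (Set.finite_Iic fun p : Σ i : Fin k, Fin (b i) => a p.1).subset ?_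
  rintro c ⟨hc, -⟩ p
  exact le_trans (Finset.single_le_sum (f := fun j => c ⟨p.1, j⟩) (fun j _ => Nat.zero_le _)
    (Finset.mem_univ p.2)) (hc p.1)

theorem convexHull_natPoints_eq_blockPolyhedron :
    convexHull ℝ ((fun (c : (Σ i : Fin k, Fin (b i)) → ℕ) p => (c p : ℝ)) ''
      {c | (∀ i, ∑ j, c ⟨i, j⟩ ≤ a i) ∧ m ≤ ∑ p, c p}) = blockPolyhedron a b m := by
  apply subset_antisymm
  · refine convexHull_min ?_ convex_blockPolyhedron
    rintro _ ⟨c, ⟨hc1, hc2⟩, rfl⟩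
    refine ⟨fun p => Nat.cast_nonneg _, fun i => ?_, ?_⟩ <;> dsimp only <;> norm_cast
    exact hc1 i
  · rw [← closure_convexHull_extremePoints isCompact_blockPolyhedron convex_blockPolyhedron]
    refine closure_minimal (convexHull_mono fun x hx => ?_)
      ((finite_natPoints_blockPolyhedron.image _).isCompact_convexHull ℝ).isClosed
    obtain ⟨hx1, hx2, hx3⟩ := hx.1
    have hnat : ∀ p, ∃ n : ℕ, (n : ℝ) = x p := fun p => by
      obtain ⟨z, hz⟩ := mem_integerReals_of_mem_extremePoints_blockPolyhedron hx p
      have hz' : (z : ℝ) = x p := hz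
      have h0 : 0 ≤ z := by exact_mod_cast hz' ▸ hx1 p
      lift z to ℕ using h0
      exact ⟨z, mod_cast hz'⟩
    choose c hc using hnat
    obtain rfl : (fun p => (c p : ℝ)) = x := funext hc
    dsimp only at hx2 hx3
    exact ⟨c, ⟨fun i => mod_cast hx2 i, mod_cast hx3⟩, rfl⟩

end

/-- The lattice polytope `P` of the secant of the Segre–Veronese variety equals the
polyhedron cut out by its defining inequalities. -/
theorem stmt_0 (k : ℕ) (hk : 1 ≤ k) (a b : Fin k → ℕ)
    (ha : ∀ i, 1 ≤ a i) (hb : ∀ i, 1 ≤ b i)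
    (S : Set ((Σ i : Fin k, Fin (b i)) → ℕ))
    (hS : S = {c | (∀ i : Fin k, ∑ j, c ⟨i, j⟩ ≤ a i) ∧ 2 ≤ ∑ p, c p})
    (P : Set ((Σ i : Fin k, Fin (b i)) → ℝ))
    (hP : P = convexHull ℝ ((fun (c : (Σ i : Fin k, Fin (b i)) → ℕ)
      (p : Σ i : Fin k, Fin (b i)) => (c p : ℝ)) '' S)) :
    P = {x : (Σ i : Fin k, Fin (b i)) → ℝ |
        (∀ p, 0 ≤ x p) ∧ (∀ i : Fin k, ∑ j, x ⟨i, j⟩ ≤ (a i : ℝ)) ∧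
        2 ≤ ∑ p, x p} := by
  subst hS hP
  simpa [blockPolyhedron] using convexHull_natPoints_eq_blockPolyhedron (a := a) (b := b) (m := 2)
end

section
/- The polytope P has the integer decomposition property (it is a normal polytope): for every natural number m and every q : I → ℕ satisfying ∑ j, q ⟨i,j⟩ ≤ m · (a i) for all i : Fin k and 2·m ≤ ∑ p, q p, there exists a family c : Fin m → (I → ℕ) with c l ∈ S for every l and q = ∑ l, c l. (This is the normality part of the paper's lemma on the polytope P; it implies that the secant variety of the Segre–Veronese variety is normal on the toric charts.) -/
open Finset

/-- Consecutive intervals of lengths `q i`, `i ∈ s`, tile an interval starting at `x`, so the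
increments of any monotone function over them telescope. -/
theorem exists_starts_sum_increments {ι : Type*} (s : Finset ι) (q : ι → ℕ) (x : ℕ) :
    ∃ y : ι → ℕ, ∀ G : ℕ → ℕ, Monotone G →
      G x + ∑ i ∈ s, (G (y i + q i) - G (y i)) = G (x + ∑ i ∈ s, q i) := by
  classical
  induction s using Finset.induction_on with
  | empty => exact ⟨fun _ => 0, by simp⟩
  | insert i s hi ih =>
    obtain ⟨y, hy⟩ := ih
    refine ⟨Function.update y i (x + ∑ j ∈ s, q j), fun G hG => ?_⟩
    have hcongr : ∑ j ∈ s, (G (Function.update y i (x + ∑ j ∈ s, q j) j + q j)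
        - G (Function.update y i (x + ∑ j ∈ s, q j) j))
        = ∑ j ∈ s, (G (y j + q j) - G (y j)) := by
      refine Finset.sum_congr rfl fun j hj => ?_
      rw [Function.update_of_ne (ne_of_mem_of_not_mem hj hi)]
    rw [Finset.sum_insert hi, Finset.sum_insert hi, hcongr, Function.update_self]
    have h := hy G hG
    have hle : G (x + ∑ j ∈ s, q j) ≤ G (x + ∑ j ∈ s, q j + q i) := hG (Nat.le_add_right _ _)
    rw [show x + (q i + ∑ j ∈ s, q j) = x + ∑ j ∈ s, q j + q i by ring]
    omega

/-- Hermite's identity for natural numbers. -/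
theorem sum_range_add_div {m : ℕ} (hm : 0 < m) (x : ℕ) :
    ∑ l ∈ range m, (x + l) / m = x := by
  induction x with
  | zero =>
    refine Finset.sum_eq_zero fun l hl => ?_
    rw [zero_add, Nat.div_eq_of_lt (Finset.mem_range.1 hl)]
  | succ x ih =>
    have h₁ := Finset.sum_range_succ (fun l => (x + l) / m) m
    have h₂ := Finset.sum_range_succ' (fun l => (x + l) / m) m
    have h₃ : ∑ l ∈ range m, (x + (l + 1)) / m = ∑ l ∈ range m, (x + 1 + l) / m :=
      Finset.sum_congr rfl fun l _ => by rw [add_assoc x 1 l, add_comm 1 l]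
    have h₄ : (x + m) / m = x / m + 1 := Nat.add_div_right x hm
    simp only [add_zero] at h₂
    omega

/-- The polytope `P` has the integer decomposition property (normality of the polytope
attached to the secant of the Segre–Veronese variety). -/
theorem stmt_1 (k : ℕ) (hk : 1 ≤ k) (a b : Fin k → ℕ)
    (ha : ∀ i, 1 ≤ a i) (hb : ∀ i, 1 ≤ b i)
    (S : Set ((Σ i : Fin k, Fin (b i)) → ℕ))
    (hS : S = {c | (∀ i : Fin k, ∑ j, c ⟨i, j⟩ ≤ a i) ∧ 2 ≤ ∑ p, c p})
    (m : ℕ) (q : (Σ i : Fin k, Fin (b i)) → ℕ)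
    (hq1 : ∀ i : Fin k, ∑ j, q ⟨i, j⟩ ≤ m * a i)
    (hq2 : 2 * m ≤ ∑ p, q p) :
    ∃ c : Fin m → ((Σ i : Fin k, Fin (b i)) → ℕ),
      (∀ l, c l ∈ S) ∧ q = ∑ l, c l := by
  subst hS
  rcases Nat.eq_zero_or_pos m with rfl | hm
  · refine ⟨fun _ => q, fun l => l.elim0, ?_⟩
    ext ⟨i, j⟩
    have h := Finset.single_le_sum (f := fun j => q ⟨i, j⟩) (fun _ _ => Nat.zero_le _)
      (Finset.mem_univ j)
    have h' := hq1 i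
    simp only [zero_mul] at h'
    simpa using h.trans h'
  obtain ⟨y, hy⟩ := exists_starts_sum_increments univ (fun i => ∑ j, q ⟨i, j⟩) 0
  choose z hz using fun i => exists_starts_sum_increments univ (fun j => q ⟨i, j⟩) (y i)
  have hmono (l : ℕ) : Monotone fun x => (x + l) / m := fun u v huv =>
    Nat.div_le_div_right (Nat.add_le_add_right huv l)
  have hblock (l : ℕ) (i : Fin k) :
      ∑ j, ((z i j + q ⟨i, j⟩ + l) / m - (z i j + l) / m)
        = (y i + ∑ j, q ⟨i, j⟩ + l) / m - (y i + l) / m :=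
    Nat.eq_sub_of_add_eq' (hz i _ (hmono l))
  refine ⟨fun l p => (z p.1 p.2 + q p + l) / m - (z p.1 p.2 + l) / m, fun l => ⟨fun i => ?_, ?_⟩, ?_⟩
  · rw [hblock, Nat.sub_le_iff_le_add', ← Nat.add_mul_div_left _ _ hm]
    have := hq1 i
    exact Nat.div_le_div_right (by omega)
  · have h := hy _ (hmono l)
    rw [Fintype.sum_sigma] at hq2 ⊢
    simp only [hblock]
    simp only [zero_add, Nat.div_eq_of_lt l.isLt] at h
    rw [h, Nat.le_div_iff_mul_le hm]
    omega
  · ext p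
    rw [Finset.sum_apply, Fin.sum_univ_eq_sum_range
      (fun l => (z p.1 p.2 + q p + l) / m - (z p.1 p.2 + l) / m),
      Finset.sum_tsub_distrib _ fun l _ => hmono l (Nat.le_add_right _ _),
      sum_range_add_div hm, sum_range_add_div hm, Nat.add_sub_cancel_left]
end

section
/- Dimension of the secant polytope (first part of the paper's facet proposition): the affine span over ℝ of P is all of (I → ℝ) (equivalently, P has affine dimension n) if and only if it is NOT the case that either (D1) k = 2 and a i = 1 for all i, or (D2) k = 1 and a 0 ≤ 2. -/
open Finset

/-- Outside the degenerate cases the total degree is at least `3`. -/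
lemma three_le_sum_of_not_degenerate (k : ℕ) (hk : 1 ≤ k) (a : Fin k → ℕ) (ha : ∀ i, 1 ≤ a i)
    (h : ¬((k = 2 ∧ ∀ i, a i = 1) ∨ (k = 1 ∧ a ⟨0, hk⟩ ≤ 2))) : 3 ≤ ∑ i, a i := by
  push Not at h
  obtain ⟨h2, h1⟩ := h
  obtain rfl | rfl | hk3 : k = 1 ∨ k = 2 ∨ 3 ≤ k := by omega
  · rw [Fin.sum_univ_one]
    exact h1 rfl
  · obtain ⟨i, hi⟩ := h2 rfl
    have h0 := ha 0
    have h1 := ha 1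
    rw [Fin.sum_univ_two]
    fin_cases i <;> simp at hi <;> omega
  · calc 3 ≤ ∑ _i : Fin k, 1 := by simpa using hk3
      _ ≤ ∑ i, a i := Finset.sum_le_sum fun i _ => ha i

/-- In the degenerate cases every lattice point of the polytope has coordinate sum `2`. -/
lemma sum_eq_two_of_degenerate (k : ℕ) (hk : 1 ≤ k) (a b : Fin k → ℕ)
    (h : (k = 2 ∧ ∀ i, a i = 1) ∨ (k = 1 ∧ a ⟨0, hk⟩ ≤ 2))
    (c : (Σ i : Fin k, Fin (b i)) → ℕ) (hc : ∀ i : Fin k, ∑ j, c ⟨i, j⟩ ≤ a i)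
    (hc2 : 2 ≤ ∑ p, c p) : ∑ p, c p = 2 := by
  refine le_antisymm ?_ hc2
  rw [Fintype.sum_sigma]
  refine (Finset.sum_le_sum fun i _ => hc i).trans ?_
  rcases h with ⟨rfl, h⟩ | ⟨rfl, h⟩
  · simp [h]
  · simpa using h

/-- If the total degree is at least `3`, every standard basis vector is a difference of two
admissible exponent vectors. -/
lemma exists_admissible_add_single (k : ℕ) (a b : Fin k → ℕ)
    (ha : ∀ i, 1 ≤ a i) (hb : ∀ i, 1 ≤ b i) (h : 3 ≤ ∑ i, a i)
    (p : Σ i : Fin k, Fin (b i)) :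
    ∃ c : (Σ i : Fin k, Fin (b i)) → ℕ,
      ((∀ i : Fin k, ∑ j, c ⟨i, j⟩ ≤ a i) ∧ 2 ≤ ∑ q, c q) ∧
      ((∀ i : Fin k, ∑ j, (c + Pi.single p 1 : (Σ i : Fin k, Fin (b i)) → ℕ) ⟨i, j⟩ ≤ a i) ∧
        2 ≤ ∑ q, (c + Pi.single p 1 : (Σ i : Fin k, Fin (b i)) → ℕ) q) := by
  let d : Fin k → ℕ := fun i => a i - if i = p.1 then 1 else 0
  let c : (Σ i : Fin k, Fin (b i)) → ℕ := fun q => if q.2 = ⟨0, hb q.1⟩ then d q.1 else 0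
  have hd : ∀ i, d i + (if i = p.1 then 1 else 0) = a i := by
    intro i
    have := ha i
    simp only [d]
    split_ifs <;> omega
  have hc : ∀ i, ∑ j, c ⟨i, j⟩ = d i := by
    intro i
    change ∑ j, (if j = (⟨0, hb i⟩ : Fin (b i)) then d i else 0) = d i
    rw [Finset.sum_ite_eq' _ _ fun _ => d i, if_pos (Finset.mem_univ _)]
  have hsum : ∑ q, c q + 1 = ∑ i, a i := by
    rw [Fintype.sum_sigma]
    simp_rw [hc, ← hd, Finset.sum_add_distrib]
    simp
  have hs : ∀ i, ∑ j, (Pi.single p 1 : (Σ i : Fin k, Fin (b i)) → ℕ) ⟨i, j⟩ =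
      if i = p.1 then 1 else 0 := by
    intro i
    obtain ⟨i', j'⟩ := p
    by_cases hi : i = i'
    · subst hi
      simp [Pi.single_apply]
    · simp [hi]
  refine ⟨c, ⟨fun i => ?_, by omega⟩, fun i => ?_, ?_⟩
  · rw [hc, ← hd]
    omega
  · simp only [Pi.add_apply, Finset.sum_add_distrib, hc, hs, hd, le_refl]
  · simp only [Pi.add_apply, Finset.sum_add_distrib]
    omega

/-- Dimension of the secant polytope: the affine span of `P` is all of `(I → ℝ)` iff we
are not in the degenerate cases (D1) `k = 2`, `a = (1,1)` or (D2) `k = 1`, `a ≤ 2`. -/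
theorem stmt_2 (k : ℕ) (hk : 1 ≤ k) (a b : Fin k → ℕ)
    (ha : ∀ i, 1 ≤ a i) (hb : ∀ i, 1 ≤ b i)
    (S : Set ((Σ i : Fin k, Fin (b i)) → ℕ))
    (hS : S = {c | (∀ i : Fin k, ∑ j, c ⟨i, j⟩ ≤ a i) ∧ 2 ≤ ∑ p, c p})
    (P : Set ((Σ i : Fin k, Fin (b i)) → ℝ))
    (hP : P = convexHull ℝ ((fun (c : (Σ i : Fin k, Fin (b i)) → ℕ)
      (p : Σ i : Fin k, Fin (b i)) => (c p : ℝ)) '' S)) :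
    affineSpan ℝ P = ⊤ ↔
      ¬((k = 2 ∧ ∀ i, a i = 1) ∨ (k = 1 ∧ a ⟨0, hk⟩ ≤ 2)) := by
  rw [hP, affineSpan_convexHull]
  constructor
  · intro htop hdeg
    have h0 : (0 : (Σ i : Fin k, Fin (b i)) → ℝ) ∈ affineSpan ℝ
        ((fun (c : (Σ i : Fin k, Fin (b i)) → ℕ)
          (p : Σ i : Fin k, Fin (b i)) => (c p : ℝ)) '' S) := by
      rw [htop]
      trivial
    have key : ∑ p, (0 : (Σ i : Fin k, Fin (b i)) → ℝ) p = 2 := by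
      refine affineSpan_induction (p := fun x => ∑ p, x p = 2) h0 ?_ ?_
      · rintro _ ⟨c, hc, rfl⟩
        rw [hS] at hc
        beta_reduce
        exact_mod_cast sum_eq_two_of_degenerate k hk a b hdeg c hc.1 hc.2
      · intro r u v w hu hv hw
        simp [Finset.sum_add_distrib, ← Finset.mul_sum, hu, hv, hw]
    simp at key
  · intro hdeg
    have hadm := exists_admissible_add_single k a b ha hb
      (three_le_sum_of_not_degenerate k hk a ha hdeg)
    have hne : S.Nonempty := by
      obtain ⟨c, hc, -⟩ := hadm ⟨⟨0, hk⟩, ⟨0, hb _⟩⟩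
      exact ⟨c, hS ▸ hc⟩
    rw [AffineSubspace.affineSpan_eq_top_iff_vectorSpan_eq_top_of_nonempty _ _ _ (hne.image _),
      eq_top_iff, ← (Pi.basisFun ℝ (Σ i : Fin k, Fin (b i))).span_eq, Submodule.span_le]
    rintro _ ⟨p, rfl⟩
    obtain ⟨c, hc, hc'⟩ := hadm p
    have hmem := vsub_mem_vectorSpan ℝ
      (Set.mem_image_of_mem (fun (c : (Σ i : Fin k, Fin (b i)) → ℕ)
        (p : Σ i : Fin k, Fin (b i)) => (c p : ℝ)) (hS ▸ hc' : c + Pi.single p 1 ∈ S))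
      (Set.mem_image_of_mem _ (hS ▸ hc : c ∈ S))
    rw [SetLike.mem_coe]
    convert hmem using 1
    ext q
    simp [Pi.single_apply]
end

section
/- Assume it is NOT the case that either (D1) k = 2 and a i = 1 for all i, or (D2) k = 1 and a 0 ≤ 2 (so P is full-dimensional). Then the face F = { x ∈ P | ∑ p, x p = 2 } is a facet of P: F is nonempty and the direction of the affine span over ℝ of F has finrank n − 1. -/
open Finset

/-- A coordinate vector has fibre sum `1` over its own block and `0` over the others. -/
lemma sum_sigma_single {ι : Type*} [DecidableEq ι] {β : ι → Type*} [∀ i, Fintype (β i)]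
    [∀ i, DecidableEq (β i)] (p : Σ i, β i) (i : ι) :
    ∑ j, (Pi.single p 1 : (Σ i, β i) → ℕ) ⟨i, j⟩ = if i = p.1 then 1 else 0 := by
  obtain ⟨i', j'⟩ := p
  by_cases h : i = i'
  · subst h
    simp [Pi.single_apply]
  · simp [h]

/-- A set on which the coordinates sum to a constant, and whose affine span has all the differences
of coordinate vectors as directions, spans a hyperplane. -/
lemma finrank_direction_affineSpan_of_sum_eq {ι : Type*} [Fintype ι] [DecidableEq ι] [Nonempty ι]
    {F : Set (ι → ℝ)} {s : ℝ} (hs : ∀ x ∈ F, ∑ p, x p = s)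
    (hdiff : ∀ p q : ι,
      (Pi.single p 1 - Pi.single q 1 : ι → ℝ) ∈ (affineSpan ℝ F).direction) :
    Module.finrank ℝ (affineSpan ℝ F).direction = Fintype.card ι - 1 := by
  let φ : (ι → ℝ) →ₗ[ℝ] ℝ := ∑ p, LinearMap.proj p
  have hφ : ∀ x, φ x = ∑ p, x p := fun x => by simp [φ]
  obtain ⟨q⟩ := ‹Nonempty ι›
  have hker : (affineSpan ℝ F).direction = LinearMap.ker φ := by
    apply le_antisymm
    · rw [direction_affineSpan, vectorSpan_def, Submodule.span_le]
      rintro _ ⟨x, hx, y, hy, rfl⟩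
      simp [hφ, hs x hx, hs y hy]
    · intro x hx
      have hx0 : ∑ p, x p = 0 := by rw [← hφ]; exact hx
      have hsum : x = ∑ p, x p • (Pi.single p 1 - Pi.single q 1 : ι → ℝ) := by
        simp_rw [smul_sub, Finset.sum_sub_distrib, ← Finset.sum_smul, hx0, zero_smul, sub_zero]
        exact pi_eq_sum_univ' x
      rw [hsum]
      exact Submodule.sum_mem _ fun p _ => Submodule.smul_mem _ _ (hdiff p q)
  have hsurj : Function.Surjective φ := fun t => ⟨Pi.single q t, by simp [hφ]⟩
  have hrank := LinearMap.finrank_range_add_finrank_ker φ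
  rw [LinearMap.range_eq_top.mpr hsurj, finrank_top, Module.finrank_self,
    Module.finrank_fintype_fun_eq_card] at hrank
  rw [hker]
  omega

/-- Outside the two defective cases, any two blocks have a common neighbour, where a block is its own
neighbour when its degree is at least `2`. -/
lemma exists_common_neighbour {k : ℕ} (hk : 1 ≤ k) {a : Fin k → ℕ} (ha : ∀ i, 1 ≤ a i)
    (hD : ¬((k = 2 ∧ ∀ i, a i = 1) ∨ (k = 1 ∧ a ⟨0, hk⟩ ≤ 2))) (i j : Fin k) :
    ∃ l, (i ≠ l ∨ 2 ≤ a i) ∧ (j ≠ l ∨ 2 ≤ a j) := by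
  push Not at hD
  obtain ⟨hD₁, hD₂⟩ := hD
  obtain rfl | rfl | hk3 : k = 1 ∨ k = 2 ∨ 3 ≤ k := by omega
  · have h := hD₂ rfl
    obtain rfl : i = ⟨0, hk⟩ := Subsingleton.elim _ _
    obtain rfl : j = ⟨0, hk⟩ := Subsingleton.elim _ _
    exact ⟨⟨0, hk⟩, Or.inr h.le, Or.inr h.le⟩
  · obtain ⟨m, hm⟩ := hD₁ rfl
    have hm2 : 2 ≤ a m := by have := ha m; omega
    by_cases hij : i = j
    · subst hij
      exact ⟨i + 1, by left; revert i; decide, by left; revert i; decide⟩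
    · refine ⟨m, ?_, ?_⟩
      · by_cases h : i = m
        · exact Or.inr (h ▸ hm2)
        · exact Or.inl h
      · by_cases h : j = m
        · exact Or.inr (h ▸ hm2)
        · exact Or.inl h
  · obtain ⟨l, hl⟩ : ∃ l, l ∉ ({i, j} : Finset (Fin k)) := by
      by_contra! h
      have hcard := Finset.card_le_card (fun x _ => h x : (univ : Finset (Fin k)) ⊆ {i, j})
      rw [Finset.card_univ, Fintype.card_fin] at hcard
      have := Finset.card_le_two (a := i) (b := j)
      omega
    simp only [Finset.mem_insert, Finset.mem_singleton, not_or] at hl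
    exact ⟨l, Or.inl (Ne.symm hl.1), Or.inl (Ne.symm hl.2)⟩

/-- In the full-dimensional case, `F = {x ∈ P | ∑ p, x p = 2}` is a facet of `P`. -/
theorem stmt_3 (k : ℕ) (hk : 1 ≤ k) (a b : Fin k → ℕ)
    (ha : ∀ i, 1 ≤ a i) (hb : ∀ i, 1 ≤ b i)
    (S : Set ((Σ i : Fin k, Fin (b i)) → ℕ))
    (hS : S = {c | (∀ i : Fin k, ∑ j, c ⟨i, j⟩ ≤ a i) ∧ 2 ≤ ∑ p, c p})
    (P : Set ((Σ i : Fin k, Fin (b i)) → ℝ))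
    (hP : P = convexHull ℝ ((fun (c : (Σ i : Fin k, Fin (b i)) → ℕ)
      (p : Σ i : Fin k, Fin (b i)) => (c p : ℝ)) '' S))
    (hD : ¬((k = 2 ∧ ∀ i, a i = 1) ∨ (k = 1 ∧ a ⟨0, hk⟩ ≤ 2)))
    (F : Set ((Σ i : Fin k, Fin (b i)) → ℝ))
    (hF : F = {x ∈ P | ∑ p, x p = 2}) :
    F.Nonempty ∧
      Module.finrank ℝ (affineSpan ℝ F).direction = (∑ i, b i) - 1 := by
  have hmem : ∀ p r : (Σ i : Fin k, Fin (b i)), (p.1 ≠ r.1 ∨ 2 ≤ a p.1) →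
      (Pi.single p 1 + Pi.single r 1 : (Σ i : Fin k, Fin (b i)) → ℝ) ∈ F := by
    intro p r hpr
    rw [hF, hP, hS]
    refine ⟨subset_convexHull ℝ _ ⟨Pi.single p 1 + Pi.single r 1, ⟨fun i => ?_, ?_⟩, ?_⟩, ?_⟩
    · simp only [Pi.add_apply, Finset.sum_add_distrib]
      rw [sum_sigma_single p i, sum_sigma_single r i]
      have := ha i
      by_cases hp : i = p.1 <;> by_cases hr : i = r.1 <;> simp only [hp, hr, if_true, if_false]
      · obtain h | h := hpr
        · exact absurd (hp.symm.trans hr) h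
        · rw [← hr, hp]
          simpa using h
      all_goals grind
    · simp [Finset.sum_add_distrib]
    · funext q
      simp [Pi.single_apply]
    · simp only [Pi.add_apply, Finset.sum_add_distrib, Finset.sum_pi_single', Finset.mem_univ,
        if_true]
      norm_num
  have hcommon : ∀ p q : (Σ i : Fin k, Fin (b i)), ∃ r : (Σ i : Fin k, Fin (b i)),
      (p.1 ≠ r.1 ∨ 2 ≤ a p.1) ∧ (q.1 ≠ r.1 ∨ 2 ≤ a q.1) := by
    intro p q
    obtain ⟨l, hl⟩ := exists_common_neighbour hk ha hD p.1 q.1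
    exact ⟨⟨l, ⟨0, hb l⟩⟩, hl⟩
  have hne : Nonempty (Σ i : Fin k, Fin (b i)) := ⟨⟨⟨0, hk⟩, ⟨0, hb _⟩⟩⟩
  constructor
  · obtain ⟨p⟩ := hne
    obtain ⟨r, hr, -⟩ := hcommon p p
    exact ⟨_, hmem p r hr⟩
  · rw [finrank_direction_affineSpan_of_sum_eq (s := 2) (fun x hx => ?_) fun p q => ?_]
    · simp
    · rw [hF] at hx
      exact hx.2
    · obtain ⟨r, hp, hq⟩ := hcommon p q
      have h := AffineSubspace.vsub_mem_direction (subset_affineSpan ℝ F (hmem p r hp))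
        (subset_affineSpan ℝ F (hmem q r hq))
      simpa using h
end

section
/- Assume it is NOT the case that either (D1) k = 2 and a i = 1 for all i, or (D2) k = 1 and a 0 ≤ 2 (so P is full-dimensional). Then for every i₀ : Fin k the face R_{i₀} = { x ∈ P | ∑ j, x ⟨i₀,j⟩ = a i₀ } is a facet of P: R_{i₀} is nonempty and the direction of the affine span over ℝ of R_{i₀} has finrank n − 1. -/
open Finset

/-- The sum of `Pi.single p m` over the block `i`. -/
lemma sum_block_single {k : ℕ} {b : Fin k → ℕ} {M : Type*} [AddCommMonoid M]
    (p : Σ i : Fin k, Fin (b i)) (m : M) (i : Fin k) :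
    ∑ j, (Pi.single p m : (Σ i : Fin k, Fin (b i)) → M) ⟨i, j⟩ = if p.1 = i then m else 0 := by
  obtain ⟨i', j'⟩ := p
  by_cases h : i' = i
  · subst h
    rw [Finset.sum_eq_single j']
    · simp
    · intro j _ hj
      exact Pi.single_eq_of_ne (by simpa using hj) _
    · simp
  · rw [if_neg h]
    refine Finset.sum_eq_zero fun j _ => Pi.single_eq_of_ne ?_ _
    intro h'
    exact h (congrArg Sigma.fst h').symm

/-- Outside the two degenerate cases, one can find a vector `h` supported off the block `i₀` which,
added to a vector filling the block `i₀`, gives total degree at least `2`, and leaves room for one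
more unit in the block `i₁`. -/
lemma exists_complement {k : ℕ} (hk : 1 ≤ k) {a b : Fin k → ℕ}
    (ha : ∀ i, 1 ≤ a i) (hb : ∀ i, 1 ≤ b i)
    (hD : ¬((k = 2 ∧ ∀ i, a i = 1) ∨ (k = 1 ∧ a ⟨0, hk⟩ ≤ 2))) (i₀ i₁ : Fin k) :
    ∃ h : (Σ i : Fin k, Fin (b i)) → ℕ, ∑ j, h ⟨i₀, j⟩ = 0 ∧
      (∀ i, i ≠ i₀ → ∑ j, h ⟨i, j⟩ + (if i₁ = i then 1 else 0) ≤ a i) ∧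
      2 ≤ a i₀ + ∑ p, h p := by
  by_cases h2 : 2 ≤ a i₀
  · refine ⟨0, by simp, fun i _ => ?_, by simpa using h2⟩
    have := ha i
    simp only [Pi.zero_apply, Finset.sum_const_zero]
    split_ifs <;> omega
  have h1 : a i₀ = 1 := by have := ha i₀; omega
  obtain ⟨i, hi, hi'⟩ : ∃ i, i ≠ i₀ ∧ (i₁ = i → 2 ≤ a i) := by
    by_contra! hcon
    have hall : ∀ i, a i = 1 := by
      intro i
      by_cases hi : i = i₀
      · rw [hi, h1]
      · have := ha i
        have := (hcon i hi).2
        omega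
    have hcard : Fintype.card (Fin k) ≤ 2 := by
      rw [← Finset.card_univ]
      refine (Finset.card_le_card (t := {i₀, i₁}) fun i _ => ?_).trans Finset.card_le_two
      by_cases hi : i = i₀
      · simp [hi]
      · simp [(hcon i hi).1]
    rw [Fintype.card_fin] at hcard
    apply hD
    obtain rfl | rfl : k = 1 ∨ k = 2 := by omega
    · exact Or.inr ⟨rfl, by rw [hall]; norm_num⟩
    · exact Or.inl ⟨rfl, hall⟩
  refine ⟨Pi.single ⟨i, 0, hb i⟩ 1, ?_, fun i' _ => ?_, ?_⟩
  · rw [sum_block_single, if_neg hi]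
  · rw [sum_block_single]
    have := ha i'
    dsimp only
    split_ifs with h h'
    · subst h
      exact hi' h'
    all_goals omega
  · rw [Finset.sum_pi_single', h1]
    simp

/-- The difference of `e_p` and (if `p` is in the block `i₀`) a fixed unit vector `e_q` of the
block `i₀` is a difference of two lattice points on the face attached to `i₀`. -/
lemma exists_lattice_points {k : ℕ} (hk : 1 ≤ k) {a b : Fin k → ℕ}
    (ha : ∀ i, 1 ≤ a i) (hb : ∀ i, 1 ≤ b i)
    (hD : ¬((k = 2 ∧ ∀ i, a i = 1) ∨ (k = 1 ∧ a ⟨0, hk⟩ ≤ 2)))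
    (p q : Σ i : Fin k, Fin (b i)) :
    ∃ c d : (Σ i : Fin k, Fin (b i)) → ℕ,
      ((∀ i, ∑ j, c ⟨i, j⟩ ≤ a i) ∧ 2 ≤ ∑ r, c r) ∧ ∑ j, c ⟨q.1, j⟩ = a q.1 ∧
      ((∀ i, ∑ j, d ⟨i, j⟩ ≤ a i) ∧ 2 ≤ ∑ r, d r) ∧ ∑ j, d ⟨q.1, j⟩ = a q.1 ∧
      c + (if p.1 = q.1 then Pi.single q 1 else 0) = d + Pi.single p 1 := by
  obtain ⟨h, h0, h1, h2⟩ := exists_complement hk ha hb hD q.1 p.1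
  have haq := ha q.1
  by_cases hp : p.1 = q.1
  · refine ⟨h + Pi.single q (a q.1 - 1) + Pi.single p 1,
      h + Pi.single q (a q.1 - 1) + Pi.single q 1, ⟨fun i => ?_, ?_⟩, ?_, ⟨fun i => ?_, ?_⟩, ?_, ?_⟩
    case refine_7 => rw [if_pos hp]; abel
    all_goals simp only [Pi.add_apply, Finset.sum_add_distrib, sum_block_single,
      Finset.sum_pi_single', Finset.mem_univ, if_true, hp]
    case refine_1 | refine_4 =>
      by_cases hi : q.1 = i
      · subst hi
        simp only [if_true]
        omega
      · have := h1 i (Ne.symm hi)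
        simp only [if_neg hi]
        omega
    all_goals omega
  · refine ⟨h + Pi.single q (a q.1) + Pi.single p 1,
      h + Pi.single q (a q.1), ⟨fun i => ?_, ?_⟩, ?_, ⟨fun i => ?_, ?_⟩, ?_, ?_⟩
    case refine_7 => rw [if_neg hp, add_zero]
    all_goals simp only [Pi.add_apply, Finset.sum_add_distrib, sum_block_single,
      Finset.sum_pi_single', Finset.mem_univ, if_true, if_neg hp]
    case refine_1 | refine_4 =>
      by_cases hi : q.1 = i
      · subst hi
        simp only [if_true, if_neg hp]
        omega
      · have := h1 i (Ne.symm hi)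
        simp only [if_neg hi]
        omega
    all_goals omega

/-- The linear form summing the coordinates of a block. -/
def blockSum {k : ℕ} (b : Fin k → ℕ) (i : Fin k) : ((Σ i : Fin k, Fin (b i)) → ℝ) →ₗ[ℝ] ℝ :=
  ∑ j, LinearMap.proj ⟨i, j⟩

lemma blockSum_apply {k : ℕ} (b : Fin k → ℕ) (i : Fin k) (x : (Σ i : Fin k, Fin (b i)) → ℝ) :
    blockSum b i x = ∑ j, x ⟨i, j⟩ := by
  simp [blockSum]

/-- The kernel of `blockSum b q.1` is contained in any submodule containing the vectors `e_p` for
`p` outside the block of `q`, and `e_p - e_q` for `p` in the block of `q`. -/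
lemma ker_blockSum_le {k : ℕ} {b : Fin k → ℕ} (q : Σ i : Fin k, Fin (b i))
    (D : Submodule ℝ ((Σ i : Fin k, Fin (b i)) → ℝ))
    (h : ∀ p, Pi.single p 1 - (if p.1 = q.1 then Pi.single q 1 else 0) ∈ D) :
    LinearMap.ker (blockSum b q.1) ≤ D := by
  intro x hx
  rw [LinearMap.mem_ker, blockSum_apply] at hx
  have hzero : ∑ p, x p • (if p.1 = q.1 then Pi.single q 1 else 0 :
      (Σ i : Fin k, Fin (b i)) → ℝ) = 0 := by
    simp only [smul_ite, smul_zero]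
    rw [Fintype.sum_sigma, Finset.sum_eq_single q.1]
    · simp only [if_true]
      rw [← Finset.sum_smul, hx, zero_smul]
    · intro i _ hi
      simp [hi]
    · simp
  have hx' : x = ∑ p, x p • (Pi.single p 1 -
      (if p.1 = q.1 then Pi.single q 1 else 0) : (Σ i : Fin k, Fin (b i)) → ℝ) := by
    simp only [smul_sub, Finset.sum_sub_distrib]
    rw [hzero, sub_zero]
    exact pi_eq_sum_univ' x
  rw [hx']
  exact Submodule.sum_mem _ fun p _ => D.smul_mem _ (h p)

/-- In the full-dimensional case, for every `i₀`, the set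
`R_{i₀} = {x ∈ P | ∑ j, x ⟨i₀,j⟩ = a i₀}` is a facet of `P`. -/
theorem stmt_4 (k : ℕ) (hk : 1 ≤ k) (a b : Fin k → ℕ)
    (ha : ∀ i, 1 ≤ a i) (hb : ∀ i, 1 ≤ b i)
    (S : Set ((Σ i : Fin k, Fin (b i)) → ℕ))
    (hS : S = {c | (∀ i : Fin k, ∑ j, c ⟨i, j⟩ ≤ a i) ∧ 2 ≤ ∑ p, c p})
    (P : Set ((Σ i : Fin k, Fin (b i)) → ℝ))
    (hP : P = convexHull ℝ ((fun (c : (Σ i : Fin k, Fin (b i)) → ℕ)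
      (p : Σ i : Fin k, Fin (b i)) => (c p : ℝ)) '' S))
    (hD : ¬((k = 2 ∧ ∀ i, a i = 1) ∨ (k = 1 ∧ a ⟨0, hk⟩ ≤ 2)))
    (i₀ : Fin k) (R : Set ((Σ i : Fin k, Fin (b i)) → ℝ))
    (hR : R = {x ∈ P | ∑ j, x ⟨i₀, j⟩ = (a i₀ : ℝ)}) :
    R.Nonempty ∧
      Module.finrank ℝ (affineSpan ℝ R).direction = (∑ i, b i) - 1 := by
  let q : Σ i : Fin k, Fin (b i) := ⟨i₀, 0, hb i₀⟩
  have hmem : ∀ c : (Σ i : Fin k, Fin (b i)) → ℕ, ((∀ i, ∑ j, c ⟨i, j⟩ ≤ a i) ∧ 2 ≤ ∑ r, c r) →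
      ∑ j, c ⟨i₀, j⟩ = a i₀ → (fun p => (c p : ℝ)) ∈ R := by
    intro c hc hc'
    rw [hR, hP, hS]
    exact ⟨subset_convexHull ℝ _ ⟨c, hc, rfl⟩, by beta_reduce; exact_mod_cast hc'⟩
  refine ⟨?_, ?_⟩
  · obtain ⟨c, -, hc, hc', -⟩ := exists_lattice_points hk ha hb hD q q
    exact ⟨_, hmem c hc hc'⟩
  have hdir : (affineSpan ℝ R).direction = LinearMap.ker (blockSum b i₀) := by
    apply le_antisymm
    · rw [direction_affineSpan, vectorSpan_def, Submodule.span_le]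
      rintro _ ⟨x, hx, y, hy, rfl⟩
      rw [hR] at hx hy
      beta_reduce
      rw [SetLike.mem_coe, LinearMap.mem_ker, vsub_eq_sub, map_sub, blockSum_apply,
        blockSum_apply, hx.2, hy.2, sub_self]
    · refine ker_blockSum_le q _ fun p => ?_
      obtain ⟨c, d, hc, hc', hd, hd', hcd⟩ := exists_lattice_points hk ha hb hD p q
      have heq : (Pi.single p 1 - (if p.1 = q.1 then Pi.single q 1 else 0) :
          (Σ i : Fin k, Fin (b i)) → ℝ) = (fun r => (c r : ℝ)) -ᵥ (fun r => (d r : ℝ)) := by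
        funext r
        have hr := congrArg (Nat.cast : ℕ → ℝ) (congrFun hcd r)
        by_cases hpq : p.1 = q.1
        · simp only [if_pos hpq, Pi.add_apply, Pi.single_apply] at hr
          simp only [if_pos hpq, vsub_eq_sub, Pi.sub_apply, Pi.single_apply]
          push_cast at hr
          linarith
        · simp only [if_neg hpq, Pi.add_apply, Pi.single_apply, Pi.zero_apply] at hr
          simp only [if_neg hpq, vsub_eq_sub, Pi.sub_apply, Pi.single_apply, Pi.zero_apply]
          push_cast at hr
          linarith
      rw [heq, direction_affineSpan]
      exact vsub_mem_vectorSpan ℝ (hmem c hc hc') (hmem d hd hd')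
  have hne : blockSum b i₀ ≠ 0 := by
    intro h0
    have := LinearMap.congr_fun h0 (Pi.single q 1)
    rw [blockSum_apply, sum_block_single, if_pos rfl] at this
    exact one_ne_zero this
  have hker := Module.Dual.finrank_ker_add_one_of_ne_zero hne
  rw [Module.finrank_fintype_fun_eq_card, Fintype.card_sigma] at hker
  simp only [Fintype.card_fin] at hker
  rw [hdir]
  omega
end

section
/- Classification of the coordinate facets (the paper's facet proposition, exceptions E1–E4). Assume a is monotone (a i ≤ a i' whenever i ≤ i') and assume it is NOT the case that either (D1) k = 2 and a i = 1 for all i, or (D2) k = 1 and a 0 ≤ 2 (so P is full-dimensional). Then for p = ⟨i₀, j₀⟩ ∈ I, the set Z_p = { x ∈ P | x p = 0 } is a facet of P (meaning: Z_p is nonempty and the direction of the affine span over ℝ of Z_p has finrank n − 1) if and only if NONE of the following holds: (E1) k = 3, b i₀ = 1, and a i = 1 for all i ≠ i₀; (E2) k = 2, i₀ = 0, b 0 = 1, a 0 ≤ 2, and a 1 = 2; (E3) k = 2, i₀ = 1, b 1 = 1, a 0 ≤ 2, and 2 ≤ a 1; (E4) k = 1 and b 0 = 1. -/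
open Finset

/-- The full-dimensionality hypothesis says that the degrees sum to at least `3`. -/
theorem three_le_sum_degrees {k : ℕ} (hk : 1 ≤ k) {a : Fin k → ℕ} (ha : ∀ i, 1 ≤ a i)
    (hD : ¬((k = 2 ∧ ∀ i, a i = 1) ∨ (k = 1 ∧ a ⟨0, hk⟩ ≤ 2))) : 3 ≤ ∑ i, a i := by
  have hcard : k ≤ ∑ i, a i := by
    simpa using Finset.card_nsmul_le_sum univ a 1 (fun i _ => ha i)
  by_contra! hlt
  have hk3 : k < 3 := by omega
  interval_cases k
  · simp at hlt hD
    omega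
  · rw [Fin.sum_univ_two] at hlt
    have h0 := ha 0
    have h1 := ha 1
    refine hD (Or.inl ⟨rfl, Fin.forall_fin_two.mpr ⟨by omega, by omega⟩⟩)

/-- The exceptional cases are those in which the coordinate is alone in its block and the
degrees of the other blocks sum to at most `2`. -/
theorem exceptional_iff {k : ℕ} (hk : 1 ≤ k) {a : Fin k → ℕ} (ha : ∀ i, 1 ≤ a i)
    (hmono : Monotone a) (hD : ¬((k = 2 ∧ ∀ i, a i = 1) ∨ (k = 1 ∧ a ⟨0, hk⟩ ≤ 2)))
    (i₀ : Fin k) (m : ℕ) :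
    ((k = 3 ∧ m = 1 ∧ ∀ i, i ≠ i₀ → a i = 1) ∨
      (k = 2 ∧ (i₀ : ℕ) = 0 ∧ m = 1 ∧ a i₀ ≤ 2 ∧ ∀ i, i ≠ i₀ → a i = 2) ∨
      (k = 2 ∧ (i₀ : ℕ) = 1 ∧ m = 1 ∧ (∀ i, i ≠ i₀ → a i ≤ 2) ∧ 2 ≤ a i₀) ∨
      (k = 1 ∧ m = 1)) ↔ m = 1 ∧ ∑ i ∈ univ.erase i₀, a i ≤ 2 := by
  have hc : (univ.erase i₀).card = k - 1 := by simp
  have hsum := Finset.sum_erase_add univ a (mem_univ i₀)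
  have hthree := three_le_sum_degrees hk ha hD
  constructor
  · rintro (⟨rfl, hm, h⟩ | ⟨rfl, -, hm, -, h⟩ | ⟨rfl, -, hm, h, -⟩ | ⟨rfl, hm⟩) <;>
      refine ⟨hm, ?_⟩
    · simpa using Finset.sum_le_card_nsmul (univ.erase i₀) a 1
        (fun i hi => (h i (ne_of_mem_erase hi)).le)
    · simpa using Finset.sum_le_card_nsmul (univ.erase i₀) a 2
        (fun i hi => (h i (ne_of_mem_erase hi)).le)
    · simpa using Finset.sum_le_card_nsmul (univ.erase i₀) a 2
        (fun i hi => h i (ne_of_mem_erase hi))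
    · rw [Finset.card_eq_zero.mp hc]
      simp
  · rintro ⟨hm, h⟩
    have hle : k - 1 ≤ ∑ i ∈ univ.erase i₀, a i := by
      simpa using Finset.card_nsmul_le_sum (univ.erase i₀) a 1 (fun i _ => ha i)
    have hk4 : k < 4 := by omega
    interval_cases k
    · exact Or.inr (Or.inr (Or.inr ⟨rfl, hm⟩))
    · have h01 : a 0 ≤ a 1 := hmono (by decide)
      have h0 := ha 0
      rw [Fin.sum_univ_two] at hsum hthree
      generalize ∑ i ∈ univ.erase i₀, a i = t at *
      have hcases : ∀ i : Fin 2, i = 0 ∨ i = 1 := by decide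
      obtain rfl | rfl := hcases i₀
      · refine Or.inr (Or.inl ⟨rfl, rfl, hm, by omega, fun i hi => ?_⟩)
        obtain rfl := (hcases i).resolve_left hi
        omega
      · refine Or.inr (Or.inr (Or.inl ⟨rfl, rfl, hm, fun i hi => ?_, by omega⟩))
        obtain rfl := (hcases i).resolve_right hi
        omega
    · refine Or.inl ⟨rfl, hm, fun i hi => ?_⟩
      have hi' := Finset.sum_erase_add (univ.erase i₀) a (mem_erase.mpr ⟨hi, mem_univ i⟩)
      have hc' : ((univ.erase i₀).erase i).card = 1 := by
        rw [card_erase_of_mem (mem_erase.mpr ⟨hi, mem_univ i⟩), hc]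
      have hrest : 1 ≤ ∑ j ∈ (univ.erase i₀).erase i, a j := by
        simpa only [hc', smul_eq_mul, mul_one] using
          Finset.card_nsmul_le_sum ((univ.erase i₀).erase i) a 1 (fun i _ => ha i)
      have := ha i
      omega

/-- Outside the exceptional cases there are representatives `r` of the blocks and
multiplicities `d` supported away from the coordinate `p`, of total at least `3`. -/
theorem exists_multiplicities {k : ℕ} {a b : Fin k → ℕ} (ha : ∀ i, 1 ≤ a i)
    (hb : ∀ i, 1 ≤ b i) (hthree : 3 ≤ ∑ i, a i) (p : Σ i : Fin k, Fin (b i))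
    (hp : b p.1 = 1 → 3 ≤ ∑ i ∈ univ.erase p.1, a i) :
    ∃ (r : ∀ i, Fin (b i)) (d : Fin k → ℕ), (∀ i, d i ≤ a i) ∧ 3 ≤ ∑ i, d i ∧
      (p.2 = r p.1 → d p.1 = 0) ∧ ∀ q, q ≠ p → 1 ≤ d q.1 := by
  by_cases h1 : b p.1 = 1
  · refine ⟨fun i => ⟨0, hb i⟩, Function.update a p.1 0, fun i => ?_, ?_, by simp, ?_⟩
    · by_cases hi : i = p.1
      · subst hi
        simp
      · simp [hi]
    · rw [Finset.sum_update_of_mem (mem_univ _), zero_add, sdiff_singleton_eq_erase]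
      exact hp h1
    · rintro ⟨i, j⟩ hq
      have hi : i ≠ p.1 := by
        rintro rfl
        refine hq (Sigma.ext rfl (heq_of_eq (Fin.ext ?_)))
        have := j.2
        have := p.2.2
        simp only at *
        omega
      simpa [hi] using ha i
  · have hnt : Nontrivial (Fin (b p.1)) :=
      Fin.nontrivial_iff_two_le.mpr (by have := hb p.1; omega)
    obtain ⟨j, hj⟩ := exists_ne p.2
    refine ⟨Function.update (fun i => ⟨0, hb i⟩) p.1 j, a, fun _ => le_rfl, hthree, ?_,
      fun q _ => ha q.1⟩
    intro h
    exact absurd (by simpa using h.symm) hj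

/-- The coordinate hyperplane `x p = 0` has codimension one. -/
theorem finrank_ker_proj {ι : Type*} [Fintype ι] (p : ι) :
    Module.finrank ℝ (LinearMap.ker (LinearMap.proj (R := ℝ) (φ := fun _ : ι => ℝ) p)) =
      Fintype.card ι - 1 := by
  classical
  have h := LinearMap.finrank_range_add_finrank_ker
    (LinearMap.proj (R := ℝ) (φ := fun _ : ι => ℝ) p)
  rw [LinearMap.range_eq_top.mpr (LinearMap.proj_surjective p)] at h
  simp at h
  omega

/-- The point with multiplicity `d i` at the representative `r i` of each block. -/
def blockPoint {k : ℕ} {b : Fin k → ℕ} (r : ∀ i, Fin (b i)) (d : Fin k → ℕ) :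
    (Σ i : Fin k, Fin (b i)) → ℕ :=
  fun q => if q.2 = r q.1 then d q.1 else 0

theorem sum_blockPoint {k : ℕ} {b : Fin k → ℕ} (r : ∀ i, Fin (b i)) (d : Fin k → ℕ)
    (i : Fin k) : ∑ j, blockPoint r d ⟨i, j⟩ = d i := by
  simp [blockPoint]

/-- The affine span of a set on which `f` is constant has direction inside the kernel of `f`. -/
theorem direction_le_ker {V : Type*} [AddCommGroup V] [Module ℝ V] (f : V →ₗ[ℝ] ℝ) (t : ℝ)
    {Z : Set V} (hZ : ∀ x ∈ Z, f x = t) : (affineSpan ℝ Z).direction ≤ LinearMap.ker f := by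
  rw [direction_affineSpan, vectorSpan_def, Submodule.span_le]
  rintro _ ⟨x, hx, y, hy, rfl⟩
  simp [hZ x hx, hZ y hy]

/-- Classification of the coordinate facets `Z_p = {x ∈ P | x p = 0}`: assuming `a` is
monotone and `P` is full-dimensional, `Z_p` is a facet iff none of the exceptions
(E1)–(E4) holds. -/
theorem stmt_5 (k : ℕ) (hk : 1 ≤ k) (a b : Fin k → ℕ)
    (ha : ∀ i, 1 ≤ a i) (hb : ∀ i, 1 ≤ b i) (hmono : Monotone a)
    (S : Set ((Σ i : Fin k, Fin (b i)) → ℕ))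
    (hS : S = {c | (∀ i : Fin k, ∑ j, c ⟨i, j⟩ ≤ a i) ∧ 2 ≤ ∑ p, c p})
    (P : Set ((Σ i : Fin k, Fin (b i)) → ℝ))
    (hP : P = convexHull ℝ ((fun (c : (Σ i : Fin k, Fin (b i)) → ℕ)
      (p : Σ i : Fin k, Fin (b i)) => (c p : ℝ)) '' S))
    (hD : ¬((k = 2 ∧ ∀ i, a i = 1) ∨ (k = 1 ∧ a ⟨0, hk⟩ ≤ 2)))
    (p : Σ i : Fin k, Fin (b i)) (Z : Set ((Σ i : Fin k, Fin (b i)) → ℝ))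
    (hZ : Z = {x ∈ P | x p = 0}) :
    (Z.Nonempty ∧
      Module.finrank ℝ (affineSpan ℝ Z).direction = (∑ i, b i) - 1) ↔
    ¬((k = 3 ∧ b p.1 = 1 ∧ ∀ i, i ≠ p.1 → a i = 1) ∨
      (k = 2 ∧ (p.1 : ℕ) = 0 ∧ b p.1 = 1 ∧ a p.1 ≤ 2 ∧ ∀ i, i ≠ p.1 → a i = 2) ∨
      (k = 2 ∧ (p.1 : ℕ) = 1 ∧ b p.1 = 1 ∧ (∀ i, i ≠ p.1 → a i ≤ 2) ∧ 2 ≤ a p.1) ∨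
      (k = 1 ∧ b p.1 = 1)) := by
  classical
  have hcard : Fintype.card (Σ i : Fin k, Fin (b i)) = ∑ i, b i := by simp
  have hker := finrank_ker_proj p
  rw [hcard] at hker
  rw [exceptional_iff hk ha hmono hD]
  have hle : (affineSpan ℝ Z).direction ≤
      LinearMap.ker (LinearMap.proj (R := ℝ) (φ := fun _ => ℝ) p) :=
    direction_le_ker _ 0 (by rw [hZ]; exact fun x hx => hx.2)
  constructor
  · rintro ⟨⟨z, hz⟩, hrank⟩ ⟨hb1, hsum⟩
    have hPsub : P ⊆ {x | (∀ i, ∑ j, x ⟨i, j⟩ ≤ (a i : ℝ)) ∧ (2 : ℝ) ≤ ∑ q, x q} := by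
      rw [hP]
      refine convexHull_min ?_ ?_
      · rintro _ ⟨c, hc, rfl⟩
        rw [hS] at hc
        refine ⟨fun i => ?_, ?_⟩ <;> dsimp only
        · exact_mod_cast hc.1 i
        · exact_mod_cast hc.2
      · rintro x ⟨hx, hx'⟩ y ⟨hy, hy'⟩ s t hs ht hst
        refine ⟨fun i => ?_, ?_⟩
        · simp only [Pi.add_apply, Pi.smul_apply, smul_eq_mul, Finset.sum_add_distrib,
            ← Finset.mul_sum]
          calc _ ≤ s * (a i : ℝ) + t * a i := by gcongr <;> [exact hx i; exact hy i]
            _ = a i := by rw [← add_mul, hst, one_mul]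
        · simp only [Pi.add_apply, Pi.smul_apply, smul_eq_mul, Finset.sum_add_distrib,
            ← Finset.mul_sum]
          calc (2 : ℝ) = s * 2 + t * 2 := by rw [← add_mul, hst, one_mul]
            _ ≤ _ := by gcongr
    have htotal : ∀ x ∈ Z, ∑ q, x q = 2 := by
      intro x hx
      rw [hZ] at hx
      obtain ⟨hblock, htwo⟩ := hPsub hx.1
      refine le_antisymm ?_ htwo
      have hsub : Subsingleton (Fin (b p.1)) := Fin.subsingleton_iff_le_one.mpr hb1.le
      have hzero : ∑ j, x ⟨p.1, j⟩ = 0 :=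
        Finset.sum_eq_zero fun j _ => by rw [Subsingleton.elim j p.2]; exact hx.2
      rw [Fintype.sum_sigma, ← Finset.sum_erase_add univ _ (mem_univ p.1), hzero, add_zero]
      calc _ ≤ ∑ i ∈ univ.erase p.1, (a i : ℝ) := Finset.sum_le_sum fun i _ => hblock i
        _ ≤ 2 := by exact_mod_cast hsum
    obtain ⟨q, hq⟩ : ∃ q, q ≠ p := by
      by_contra! hall
      have hz0 : ∑ q, z q = 0 := Finset.sum_eq_zero fun q _ => by
        rw [hall q]
        rw [hZ] at hz
        exact hz.2
      linarith [htotal z hz]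
    have heq := Submodule.eq_of_le_of_finrank_eq hle (hrank.trans hker.symm)
    have hmem : Pi.single q (1 : ℝ) ∈ (affineSpan ℝ Z).direction := by
      rw [heq]
      simp [hq.symm]
    have := direction_le_ker (∑ q, LinearMap.proj (R := ℝ) (φ := fun _ => ℝ) q) 2
      (by simpa using htotal) hmem
    simp at this
  · intro hne
    obtain ⟨r, d, hda, hd3, hdp, hdq⟩ := exists_multiplicities ha hb
      (three_le_sum_degrees hk ha hD) p (fun h => by
        by_contra hlt
        exact hne ⟨h, by omega⟩)
    have hcast : ∀ c ∈ S, c p = 0 → (fun q => (c q : ℝ)) ∈ Z := by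
      intro c hc hcp
      rw [hZ, hP]
      exact ⟨subset_convexHull ℝ _ ⟨c, hc, rfl⟩, by simp [hcp]⟩
    refine ⟨⟨_, hcast (blockPoint r d) ?_ ?_⟩, ?_⟩
    · rw [hS]
      refine ⟨fun i => (sum_blockPoint r d i).trans_le (hda i), ?_⟩
      rw [Fintype.sum_sigma, Finset.sum_congr rfl fun i _ => sum_blockPoint r d i]
      exact (Nat.le_succ 2).trans hd3
    · simpa [blockPoint] using hdp
    rw [← hker, le_antisymm hle fun v hv => ?_]
    rw [LinearMap.mem_ker, LinearMap.proj_apply] at hv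
    rw [pi_eq_sum_univ' v]
    refine Submodule.sum_mem _ fun q _ => ?_
    by_cases hqp : q = p
    · simp [hqp, hv]
    refine Submodule.smul_mem _ _ ?_
    obtain ⟨e, rfl⟩ : ∃ e : Fin k → ℕ, d = e + Pi.single q.1 1 := by
      refine ⟨d - Pi.single q.1 1, (tsub_add_cancel_of_le fun i => ?_).symm⟩
      by_cases hi : i = q.1
      · subst hi
        simpa using hdq q hqp
      · simp [hi]
    have he2 : 2 ≤ ∑ i, e i := by
      simp only [Pi.add_apply, Finset.sum_add_distrib, Finset.sum_pi_single', mem_univ,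
        if_true] at hd3
      omega
    have hep : blockPoint r e p = 0 := by
      simp only [blockPoint, ite_eq_right_iff]
      intro h
      have := hdp h
      simp only [Pi.add_apply] at this
      omega
    have hblock : ∀ i, ∑ j, (Pi.single q 1 : (Σ i, Fin (b i)) → ℕ) ⟨i, j⟩ =
        (Pi.single q.1 1 : Fin k → ℕ) i := by
      rintro i
      obtain ⟨q₁, q₂⟩ := q
      by_cases hi : i = q₁
      · subst hi
        simp [Pi.single_apply]
      · simp [hi]
    have h0 : blockPoint r e ∈ S := by
      rw [hS]
      refine ⟨fun i => ?_, ?_⟩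
      · rw [sum_blockPoint]
        exact (Nat.le_add_right _ _).trans (hda i)
      · rwa [Fintype.sum_sigma, Finset.sum_congr rfl fun i _ => sum_blockPoint r e i]
    have h1 : blockPoint r e + Pi.single q 1 ∈ S := by
      rw [hS] at h0 ⊢
      refine ⟨fun i => ?_, h0.2.trans (Finset.sum_le_sum fun i _ => Nat.le_add_right _ _)⟩
      simp only [Pi.add_apply, Finset.sum_add_distrib, sum_blockPoint, hblock]
      exact hda i
    have hmem := vsub_mem_vectorSpan ℝ (hcast _ h1 (by simp [hep, Ne.symm hqp]))
      (hcast _ h0 hep)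
    rw [direction_affineSpan]
    convert hmem using 1
    ext x
    simp [Pi.single_apply, eq_comm]
end

section
/- Vertex lemma, second part: for every p = ⟨i, j⟩ ∈ I, the point 2 • e_p is an extreme point of P (over ℝ) if and only if 2 ≤ a i. -/
open Finset

/-- A linear inequality `f x ≤ r` that holds on a set holds on its convex hull. -/
theorem le_of_mem_convexHull {E : Type*} [AddCommGroup E] [Module ℝ E] (f : E →ₗ[ℝ] ℝ)
    {s : Set E} {r : ℝ} (hs : ∀ x ∈ s, f x ≤ r) {x : E} (hx : x ∈ convexHull ℝ s) : f x ≤ r :=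
  convexHull_min (t := {x | f x ≤ r}) hs (convex_halfSpace_le f.isLinear r) hx

/-- A linear inequality `r ≤ f x` that holds on a set holds on its convex hull. -/
theorem ge_of_mem_convexHull {E : Type*} [AddCommGroup E] [Module ℝ E] (f : E →ₗ[ℝ] ℝ)
    {s : Set E} {r : ℝ} (hs : ∀ x ∈ s, r ≤ f x) {x : E} (hx : x ∈ convexHull ℝ s) : r ≤ f x :=
  convexHull_min (t := {x | r ≤ f x}) hs (convex_halfSpace_ge f.isLinear r) hx

/-- In a set of nonnegative vectors with coordinate sum at least `r`, the point `r • e_p`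
is extreme as soon as it belongs to the set. -/
theorem smul_single_mem_extremePoints {ι : Type*} [Fintype ι] [DecidableEq ι] {A : Set (ι → ℝ)}
    {r : ℝ} {p : ι} (hnonneg : ∀ x ∈ A, ∀ q, 0 ≤ x q) (hsum : ∀ x ∈ A, r ≤ ∑ q, x q)
    (hp : r • Pi.single p (1 : ℝ) ∈ A) : r • Pi.single p (1 : ℝ) ∈ Set.extremePoints ℝ A := by
  rw [mem_extremePoints_iff_left]
  refine ⟨hp, fun x hx y hy ⟨s, t, hs, ht, hst, hxy⟩ => ?_⟩
  have hcoord (q : ι) : s * x q + t * y q = r * (Pi.single p (1 : ℝ) : ι → ℝ) q := by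
    simpa using congrFun hxy q
  have hzero : ∀ q, q ≠ p → x q = 0 ∧ y q = 0 := fun q hq => by
    have h := hcoord q
    rw [Pi.single_eq_of_ne hq, mul_zero, add_eq_zero_iff_of_nonneg
      (mul_nonneg hs.le (hnonneg x hx q)) (mul_nonneg ht.le (hnonneg y hy q))] at h
    simpa [hs.ne', ht.ne'] using h
  have hxp : r ≤ x p := by
    simpa [Fintype.sum_eq_single p fun q hq => (hzero q hq).1] using hsum x hx
  have hyp : r ≤ y p := by
    simpa [Fintype.sum_eq_single p fun q hq => (hzero q hq).2] using hsum y hy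
  ext q
  by_cases hq : q = p
  · subst hq
    have h := hcoord q
    simp only [Pi.single_eq_same, mul_one] at h
    simp only [Pi.smul_apply, Pi.single_eq_same, smul_eq_mul, mul_one]
    obtain rfl : t = 1 - s := by linarith
    nlinarith
  · simp [hq, (hzero q hq).1]

/-- Vertex lemma, second part: for `p = ⟨i,j⟩` in `I`, the point `2 • e_p` is a vertex of
`P` iff `2 ≤ a i`. -/
theorem stmt_7 (k : ℕ) (hk : 1 ≤ k) (a b : Fin k → ℕ)
    (ha : ∀ i, 1 ≤ a i) (hb : ∀ i, 1 ≤ b i)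
    (S : Set ((Σ i : Fin k, Fin (b i)) → ℕ))
    (hS : S = {c | (∀ i : Fin k, ∑ j, c ⟨i, j⟩ ≤ a i) ∧ 2 ≤ ∑ p, c p})
    (P : Set ((Σ i : Fin k, Fin (b i)) → ℝ))
    (hP : P = convexHull ℝ ((fun (c : (Σ i : Fin k, Fin (b i)) → ℕ)
      (p : Σ i : Fin k, Fin (b i)) => (c p : ℝ)) '' S))
    (p : Σ i : Fin k, Fin (b i)) :
    ((2 : ℝ) • (Pi.single p (1 : ℝ) : (Σ i : Fin k, Fin (b i)) → ℝ)) ∈ Set.extremePoints ℝ P ↔ 2 ≤ a p.1 := by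
  subst hS hP
  constructor
  · intro h
    have hle := le_of_mem_convexHull (r := (a p.1 : ℝ)) (LinearMap.proj p) (by
      rintro _ ⟨c, hc, rfl⟩
      exact Nat.cast_le.mpr ((single_le_sum (f := fun j => c ⟨p.1, j⟩)
        (fun _ _ => Nat.zero_le _) (mem_univ p.2)).trans (hc.1 p.1))) h.1
    simp only [LinearMap.proj_apply, Pi.smul_apply, Pi.single_eq_same, smul_eq_mul, mul_one] at hle
    exact_mod_cast hle
  · intro h
    refine smul_single_mem_extremePoints (fun x hx q => ?_) (fun x hx => ?_)
      (subset_convexHull ℝ _ ⟨Pi.single p 2, ⟨fun i => ?_, ?_⟩, ?_⟩)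
    · refine ge_of_mem_convexHull (LinearMap.proj q) ?_ hx
      rintro _ ⟨c, -, rfl⟩
      exact Nat.cast_nonneg (c q)
    · have hsum := ge_of_mem_convexHull (r := 2) (∑ q, LinearMap.proj q) (by
        rintro _ ⟨c, hc, rfl⟩
        simpa using (mod_cast hc.2 : (2 : ℝ) ≤ ∑ q, (c q : ℝ))) hx
      simpa using hsum
    · obtain ⟨i₀, j₀⟩ := p
      by_cases hi : i = i₀
      · subst hi
        simpa [Pi.single_apply] using h
      · simp [hi]
    · simp
    · ext q
      by_cases hq : q = p <;> simp [hq]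
end

section
/- First cumulant identity (Step 2 in the proof of the paper's parameterization lemma): let R be a commutative ring, π ∈ R, V a finite type, t u : V → R, and for a finite subset τ of V set x(τ) = π·(∏_{i∈τ} t i) + (1−π)·(∏_{i∈τ} u i). Then for every finite subset σ of V, writing d = card σ, one has ∑_{τ ⊆ σ} (−1)^{d + card τ} · x(τ) · ∏_{i ∈ σ \ τ} x({i}) = ( π·(1−π)^d + (−π)^d·(1−π) ) · ∏_{i ∈ σ} (t i − u i), where the sum ranges over all subsets τ of σ (including the empty set). -/
open Finset

/-- Expansion of a product of differences over subsets, with the sign written in terms of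
cardinalities. -/
theorem prod_sub_eq_sum_powerset_neg_one_pow {R V : Type*} [CommRing R] [DecidableEq V]
    (a b : V → R) (σ : Finset V) :
    ∏ i ∈ σ, (a i - b i) =
      ∑ τ ∈ σ.powerset, (-1 : R) ^ (σ.card + τ.card) * ((∏ i ∈ τ, a i) * ∏ i ∈ σ \ τ, b i) := by
  simp_rw [sub_eq_add_neg]
  rw [Finset.prod_add]
  refine Finset.sum_congr rfl fun τ hτ => ?_
  have hcard : (σ \ τ).card + τ.card = σ.card :=
    Finset.card_sdiff_add_card_eq_card (Finset.mem_powerset.mp hτ)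
  have hsq : (-1 : R) ^ τ.card * (-1) ^ τ.card = 1 := by
    rw [← mul_pow]; simp
  rw [Finset.prod_neg, ← hcard, pow_add, pow_add]
  linear_combination
    -((-1 : R) ^ (σ \ τ).card * (∏ i ∈ τ, a i) * ∏ i ∈ σ \ τ, b i) * hsq

/-- First cumulant identity (Step 2 of the parameterization lemma): the alternating sum
`y_σ` of the secant parameterization equals
`(π(1-π)^d + (-π)^d(1-π)) ∏_{i∈σ}(t i - u i)` where `d = card σ`. -/
theorem stmt_8 (R : Type*) [CommRing R] (π : R) (V : Type*) [Fintype V] [DecidableEq V]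
    (t u : V → R) (x : Finset V → R)
    (hx : ∀ τ : Finset V, x τ = π * (∏ i ∈ τ, t i) + (1 - π) * (∏ i ∈ τ, u i))
    (σ : Finset V) :
    ∑ τ ∈ σ.powerset,
        (-1 : R) ^ (σ.card + τ.card) * (x τ * ∏ i ∈ σ \ τ, x {i}) =
      (π * (1 - π) ^ σ.card + (-π) ^ σ.card * (1 - π)) * ∏ i ∈ σ, (t i - u i) := by
  have ht : ∀ i, t i - x {i} = (1 - π) * (t i - u i) := fun i => by
    rw [hx, Finset.prod_singleton, Finset.prod_singleton]; ring
  have hu : ∀ i, u i - x {i} = -π * (t i - u i) := fun i => by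
    rw [hx, Finset.prod_singleton, Finset.prod_singleton]; ring
  calc
    _ = π * ∏ i ∈ σ, (t i - x {i}) + (1 - π) * ∏ i ∈ σ, (u i - x {i}) := by
      rw [prod_sub_eq_sum_powerset_neg_one_pow, prod_sub_eq_sum_powerset_neg_one_pow,
        Finset.mul_sum, Finset.mul_sum, ← Finset.sum_add_distrib]
      refine Finset.sum_congr rfl fun τ _ => ?_
      rw [hx τ]
      ring
    _ = _ := by
      simp_rw [ht, hu, Finset.prod_mul_distrib, Finset.prod_const]
      ring
end

section
/- Composition identity (Step 3 in the proof of the paper's parameterization lemma): let R be a commutative ring, π ∈ R, and d ≥ 2 a natural number. Then ∑_c (−1)^{(length of c) + 1} · ∏_m ( π·(1−π)^m + (−π)^m·(1−π) ) = π·(1−π)·(1−2π)^{d−2}, where the sum ranges over all compositions c of d all of whose parts are ≥ 2, and the product ranges over the parts m of c. -/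
open Finset

/-- Prepending a positive block `k` to a composition of `m`. -/
def Composition.consBlock {k m n : ℕ} (hk : 0 < k) (h : k + m = n) (c : Composition m) :
    Composition n where
  blocks := k :: c.blocks
  blocks_pos := by
    intro i hi
    rcases List.mem_cons.1 hi with rfl | hi
    · exact hk
    · exact c.blocks_pos hi
  blocks_sum := by simp [c.blocks_sum, h]

/-- Summing a multiplicative weight over compositions: recurrence on the first block. -/
theorem Composition.sum_prod_blocks_succ {R : Type*} [CommRing R] (f : ℕ → R) (n : ℕ) :
    ∑ c : Composition (n + 1), (c.blocks.map f).prod =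
      ∑ i ∈ range (n + 1), f (i + 1) * ∑ c : Composition (n - i), (c.blocks.map f).prod := by
  rw [← Fin.sum_univ_eq_sum_range
    (fun i => f (i + 1) * ∑ c : Composition (n - i), (c.blocks.map f).prod)]
  simp_rw [Finset.mul_sum]
  rw [← Fintype.sum_sigma' (fun (i : Fin (n + 1)) (c : Composition (n - i)) =>
    f (i + 1) * (c.blocks.map f).prod)]
  symm
  refine Fintype.sum_bijective
    (fun x : (i : Fin (n + 1)) × Composition (n - i) =>
      x.2.consBlock (k := x.1 + 1) (n := n + 1) (Nat.succ_pos _) (by omega)) ⟨?_, ?_⟩ _ _ ?_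
  · rintro ⟨i, c⟩ ⟨j, c'⟩ h
    have hb : ((i : ℕ) + 1) :: c.blocks = ((j : ℕ) + 1) :: c'.blocks := congrArg Composition.blocks h
    obtain ⟨h1, h2⟩ := List.cons.inj hb
    obtain rfl : i = j := Fin.ext (by omega)
    obtain rfl : c = c' := Composition.ext h2
    rfl
  · rintro ⟨b, hpos, hsum⟩
    cases b with
    | nil => simp at hsum
    | cons k l =>
      have hk : 0 < k := hpos (by simp)
      rw [List.sum_cons] at hsum
      refine ⟨⟨⟨k - 1, by omega⟩, ⟨l, fun hi => hpos (List.mem_cons_of_mem _ hi), ?_⟩⟩, ?_⟩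
      · simp only
        omega
      · apply Composition.ext
        simp only [Composition.consBlock, List.cons.injEq, and_true]
        omega
  · rintro ⟨i, c⟩
    simp [Composition.consBlock]

/-- The unsigned form of the composition identity, with weights `-(π(1-π)^m + (-π)^m(1-π))`. -/
theorem Composition.sum_prod_neg_weight {R : Type*} [CommRing R] (π : R) (n : ℕ) :
    ∑ c : Composition (n + 2),
        (c.blocks.map fun m => -(π * (1 - π) ^ m + (-π) ^ m * (1 - π))).prod =
      -(π * (1 - π) * (1 - 2 * π) ^ n) := by
  set f : ℕ → R := fun m => -(π * (1 - π) ^ m + (-π) ^ m * (1 - π)) with hf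
  have h0 : ∑ c : Composition 0, (c.blocks.map f).prod = 1 := by
    have hb (c : Composition 0) : c.blocks = [] := c.blocks_eq_nil.2 rfl
    simp [hb, composition_card]
  have h1 : ∑ c : Composition 1, (c.blocks.map f).prod = 0 := by
    rw [Composition.sum_prod_blocks_succ]
    simp only [zero_add, range_one, sum_singleton, hf]
    ring
  induction n using Nat.strong_induction_on with
  | _ n ih =>
    rw [Composition.sum_prod_blocks_succ, sum_range_succ, sum_range_succ]
    have hsum : ∑ i ∈ range n, f (i + 1) *
          ∑ c : Composition (n + 1 - i), (c.blocks.map f).prod =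
        π * (1 - π) * ((1 - π) * ((∑ i ∈ range n, (1 - π) ^ i * (1 - 2 * π) ^ (n - 1 - i)) *
            ((1 - π) - (1 - 2 * π)))
          + π * ((∑ i ∈ range n, (-π) ^ i * (1 - 2 * π) ^ (n - 1 - i)) *
            ((-π) - (1 - 2 * π)))) := by
      simp only [sum_mul, mul_sum, ← sum_add_distrib]
      refine sum_congr rfl fun i hi => ?_
      have hi := mem_range.1 hi
      rw [← mul_sum, show n + 1 - i = (n - 1 - i) + 2 by omega, ih _ (by omega), hf]
      ring
    rw [hsum, geom_sum₂_mul, geom_sum₂_mul, show n + 1 - n = 1 by omega, h1, Nat.sub_self, h0, hf]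
    ring

/-- Composition identity (Step 3 of the parameterization lemma): summing over all
compositions of `d` with all parts `≥ 2` the signed products of
`π(1-π)^m + (-π)^m(1-π)` yields `π(1-π)(1-2π)^(d-2)`. -/
theorem stmt_9 (R : Type*) [CommRing R] (π : R) (d : ℕ) (hd : 2 ≤ d) :
    ∑ c ∈ Finset.univ.filter (fun c : Composition d => ∀ m ∈ c.blocks, 2 ≤ m),
        (-1 : R) ^ (c.length + 1) *
          (c.blocks.map (fun m => π * (1 - π) ^ m + (-π) ^ m * (1 - π))).prod =
      π * (1 - π) * (1 - 2 * π) ^ (d - 2) := by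
  obtain ⟨n, rfl⟩ := Nat.exists_eq_add_of_le' hd
  rw [Nat.add_sub_cancel, ← neg_neg (π * (1 - π) * _), ← Composition.sum_prod_neg_weight,
    ← sum_neg_distrib]
  have hsign (l : List ℕ) (f : ℕ → R) :
      (l.map fun m => -f m).prod = (-1) ^ l.length * (l.map f).prod := by
    induction l with
    | nil => simp
    | cons a l ih =>
      simp only [List.map_cons, List.prod_cons, List.length_cons, ih]
      ring
  rw [sum_filter]
  refine sum_congr rfl fun c _ => ?_
  rw [hsign, c.blocks_length]
  split_ifs with hc
  · ring
  · push Not at hc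
    obtain ⟨m, hm, hlt⟩ := hc
    obtain rfl : m = 1 := by
      have := c.one_le_blocks hm
      omega
    rw [List.prod_eq_zero, mul_zero, neg_zero]
    exact List.mem_map.2 ⟨1, hm, by ring⟩
end

section
/- The paper's parameterization lemma (simplicial cumulants of the secant variety): let R be a commutative ring, π ∈ R, d ≥ 2 a natural number, and t u : Fin d → R. For a finite subset τ of Fin d set x(τ) = π·(∏_{i∈τ} t i) + (1−π)·(∏_{i∈τ} u i), and for a finite subset B of Fin d set y(B) = ∑_{τ ⊆ B} (−1)^{card B + card τ} · x(τ) · ∏_{i ∈ B \ τ} x({i}). For a composition c of d with blocks of sizes c₁, …, c_m (all ≥ 2), let B_j = { i : Fin d | (sum of the first j−1 parts) ≤ i < (sum of the first j parts) } be its j-th block. Then ∑_c (−1)^{(length of c) + 1} · ∏_j y(B_j) = π·(1−π)·(1−2π)^{d−2} · ∏_{i} (t i − u i), where the sum ranges over all compositions c of d all of whose parts are ≥ 2. (This is the formula z_σ = π(1−π)(1−2π)^{dim σ − 1} ∏_{i∈σ}(t_i − u_i) for the simplicial cumulants of the secant variety.) -/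
open Finset

/-- Splitting a composition of `n + 1` at its first block. -/
theorem Composition.sum_prod_map_blocks_succ {R : Type*} [CommSemiring R] (f : ℕ → R) (n : ℕ) :
    ∑ c : Composition (n + 1), (c.blocks.map f).prod =
      ∑ j ∈ range (n + 1), f (j + 1) * ∑ c : Composition (n - j), (c.blocks.map f).prod := by
  rw [Finset.sum_range]
  simp_rw [Finset.mul_sum]
  rw [← Fintype.sum_sigma' (fun (j : Fin (n + 1)) (c : Composition (n - j)) =>
    f (j + 1) * (c.blocks.map f).prod)]
  symm
  refine Fintype.sum_bijective
    (fun p : (Σ j : Fin (n + 1), Composition (n - j)) =>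
      (⟨(p.1 + 1) :: p.2.blocks, fun {i} hi => by
          rcases List.mem_cons.1 hi with rfl | hi
          · omega
          · exact p.2.blocks_pos hi,
        by
          have := p.1.isLt
          rw [List.sum_cons, p.2.blocks_sum]
          omega⟩ : Composition (n + 1))) ⟨?_, ?_⟩ _ _ ?_
  · rintro ⟨j, c⟩ ⟨j', c'⟩ h
    have h' := congrArg Composition.blocks h
    simp only [List.cons.injEq, add_left_inj] at h'
    obtain ⟨h1, h2⟩ := h'
    obtain rfl := Fin.ext h1
    obtain rfl := Composition.ext h2
    rfl
  · rintro ⟨l, hpos, hsum⟩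
    cases l with
    | nil => simp at hsum
    | cons a l =>
      have ha : 0 < a := hpos (by simp)
      rw [List.sum_cons] at hsum
      refine ⟨⟨⟨a - 1, by omega⟩, ⟨l, fun hi => hpos (List.mem_cons_of_mem _ hi), ?_⟩⟩, ?_⟩
      · simp only
        omega
      · ext1
        simp only [List.cons.injEq, and_true]
        omega
  · rintro ⟨j, c⟩
    simp

/-- If the block weights satisfy a linear recurrence of order two starting from `-1, 0`, then
the total weight of the compositions of `n + 2` is geometric in `n`. -/
theorem Composition.sum_prod_map_blocks_of_recurrence {R : Type*} [CommRing R] {f : ℕ → R}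
    {a b : R} (h0 : f 0 = -1) (h1 : f 1 = 0)
    (hf : ∀ n, f (n + 2) = a * f (n + 1) + b * f n) (n : ℕ) :
    ∑ c : Composition (n + 2), (c.blocks.map f).prod = -(b * a ^ n) := by
  set S : ℕ → R := fun n => ∑ c : Composition n, (c.blocks.map f).prod with hS
  have hrec : ∀ n, S (n + 1) = ∑ j ∈ range (n + 1), f (j + 1) * S (n - j) :=
    Composition.sum_prod_map_blocks_succ f
  have hS0 : S 0 = 1 := by
    have hb (c : Composition 0) : c.blocks = [] := c.blocks_eq_nil.2 rfl
    simp [hS, hb, composition_card]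
  have hS1 : S 1 = 0 := by simp [hrec 0, h1]
  have hstep (n : ℕ) :
      S (n + 2) = a * S (n + 1) + b * ∑ j ∈ range (n + 1), f j * S (n - j) := by
    rw [hrec (n + 1), Finset.sum_range_succ', zero_add, h1, zero_mul, add_zero, hrec n,
      Finset.mul_sum (a := a), Finset.mul_sum (a := b) (s := range (n + 1)),
      ← Finset.sum_add_distrib]
    refine Finset.sum_congr rfl fun j _ => ?_
    rw [hf, Nat.add_sub_add_right]
    ring
  change S (n + 2) = _
  induction n with
  | zero => simp [hstep, hS1, h0, hS0]
  | succ n ih =>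
    rw [hstep, ih, Finset.sum_range_succ', h0]
    have : ∑ j ∈ range (n + 1), f (j + 1) * S (n + 1 - (j + 1)) = S (n + 1) := by
      simp only [Nat.add_sub_add_right, hrec n]
    rw [this, Nat.sub_zero]
    ring

/-- The `j`-th interval block of a composition is the range of its `j`-th embedding. -/
theorem Composition.filter_sizeUpTo_eq_map_embedding {d : ℕ} (c : Composition d)
    (j : Fin c.length) :
    univ.filter (fun i : Fin d => c.sizeUpTo j ≤ (i : ℕ) ∧ (i : ℕ) < c.sizeUpTo (j + 1)) =
      univ.map (c.embedding j).toEmbedding := by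
  ext i
  have := c.mem_range_embedding_iff (j := i) (i := j)
  simp only [Set.mem_range, Nat.succ_eq_add_one] at this
  simp [this]

/-- The first cumulant change of coordinates, evaluated at a two-term mixture of products. -/
theorem sum_powerset_mixture_eq {ι R : Type*} [DecidableEq ι] [CommRing R] (π : R) (t u : ι → R)
    (B : Finset ι) :
    ∑ τ ∈ B.powerset, (-1 : R) ^ (#B + #τ) *
        ((π * (∏ i ∈ τ, t i) + (1 - π) * (∏ i ∈ τ, u i)) *
          ∏ i ∈ B \ τ, (π * t i + (1 - π) * u i)) =
      (π * (1 - π) ^ #B + (1 - π) * (-π) ^ #B) * ∏ i ∈ B, (t i - u i) := by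
  have key (v m : ι → R) : ∑ τ ∈ B.powerset, (-1 : R) ^ (#B + #τ) *
      ((∏ i ∈ τ, v i) * ∏ i ∈ B \ τ, m i) = ∏ i ∈ B, (v i - m i) := by
    simp_rw [sub_eq_add_neg]
    rw [Finset.prod_add]
    refine Finset.sum_congr rfl fun τ hτ => ?_
    have hc : #B + #τ = #(B \ τ) + 2 * #τ := by
      have := Finset.card_sdiff_add_card_eq_card (Finset.mem_powerset.1 hτ)
      omega
    rw [hc, pow_add, pow_mul, neg_one_sq, one_pow, mul_one, Finset.prod_neg]
    ring
  have ht : ∏ i ∈ B, (t i - (π * t i + (1 - π) * u i)) =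
      (1 - π) ^ #B * ∏ i ∈ B, (t i - u i) := by
    rw [← Finset.prod_const, ← Finset.prod_mul_distrib]
    exact Finset.prod_congr rfl fun i _ => by ring
  have hu : ∏ i ∈ B, (u i - (π * t i + (1 - π) * u i)) =
      (-π) ^ #B * ∏ i ∈ B, (t i - u i) := by
    rw [← Finset.prod_const, ← Finset.prod_mul_distrib]
    exact Finset.prod_congr rfl fun i _ => by ring
  rw [add_mul, mul_assoc, mul_assoc, ← ht, ← hu, ← key, ← key, Finset.mul_sum, Finset.mul_sum,
    ← Finset.sum_add_distrib]
  exact Finset.sum_congr rfl fun τ _ => by ring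

/-- The parameterization lemma: the simplicial cumulant
`z = ∑_{c} (-1)^{length c + 1} ∏_j y(B_j)`, summed over compositions of `d` with all
parts `≥ 2` and with `B_j` the `j`-th interval block of `c`, equals
`π(1-π)(1-2π)^(d-2) ∏_i (t i - u i)`. -/
theorem stmt_10 (R : Type*) [CommRing R] (π : R) (d : ℕ) (hd : 2 ≤ d)
    (t u : Fin d → R) (x : Finset (Fin d) → R)
    (hx : ∀ τ : Finset (Fin d),
      x τ = π * (∏ i ∈ τ, t i) + (1 - π) * (∏ i ∈ τ, u i))
    (y : Finset (Fin d) → R)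
    (hy : ∀ B : Finset (Fin d),
      y B = ∑ τ ∈ B.powerset,
        (-1 : R) ^ (B.card + τ.card) * (x τ * ∏ i ∈ B \ τ, x {i})) :
    ∑ c ∈ Finset.univ.filter (fun c : Composition d => ∀ m ∈ c.blocks, 2 ≤ m),
        (-1 : R) ^ (c.length + 1) *
          ∏ j : Fin c.length,
            y (Finset.univ.filter
              (fun i : Fin d => c.sizeUpTo j ≤ (i : ℕ) ∧ (i : ℕ) < c.sizeUpTo (j + 1))) =
      π * (1 - π) * (1 - 2 * π) ^ (d - 2) * ∏ i, (t i - u i) := by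
  set k : ℕ → R := fun n => π * (1 - π) ^ n + (1 - π) * (-π) ^ n with hk
  have hk1 : k 1 = 0 := by simp only [hk]; ring
  have hyk (B : Finset (Fin d)) : y B = k #B * ∏ i ∈ B, (t i - u i) := by
    simp only [hy, hx, Finset.prod_singleton]
    exact sum_powerset_mixture_eq π t u B
  have hterm (c : Composition d) :
      (-1 : R) ^ (c.length + 1) *
          ∏ j : Fin c.length,
            y (Finset.univ.filter
              (fun i : Fin d => c.sizeUpTo j ≤ (i : ℕ) ∧ (i : ℕ) < c.sizeUpTo (j + 1))) =
        -(∏ i, (t i - u i)) * (c.blocks.map fun n => -k n).prod := by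
    have hprod : (c.blocks.map fun n => -k n).prod =
        (-1) ^ c.length * ∏ j, k (c.blocksFun j) := by
      rw [← c.ofFn_blocksFun, List.map_ofFn, List.prod_ofFn]
      simp [Finset.prod_neg]
    simp only [c.filter_sizeUpTo_eq_map_embedding, hyk, Finset.card_map, Finset.card_univ,
      Fintype.card_fin, Finset.prod_map, Finset.prod_mul_distrib, RelEmbedding.coe_toEmbedding]
    rw [c.prod_prod_apply_embedding fun i => t i - u i, hprod]
    ring
  rw [Finset.sum_filter_of_ne, Finset.sum_congr rfl fun c _ => hterm c, ← Finset.mul_sum]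
  · obtain ⟨n, rfl⟩ := Nat.exists_eq_add_of_le' hd
    rw [Composition.sum_prod_map_blocks_of_recurrence (a := 1 - 2 * π) (b := π * (1 - π))
      (by simp [hk]) (by simp [hk1]) (fun n => by simp only [hk]; ring), Nat.add_sub_cancel]
    ring
  · intro c _ hc m hm
    by_contra hlt
    have hm1 : m = 1 := by
      have := c.one_le_blocks hm
      omega
    refine hc ?_
    rw [hterm, List.prod_eq_zero, mul_zero]
    exact List.mem_map.2 ⟨m, hm, by simp [hm1, hk1]⟩
end

section
/- Diophantine core of the Gorenstein classification (Case with all facets present in the paper's Gorenstein theorem): let k ≥ 1, a b : Fin k → ℕ with 1 ≤ a i and 1 ≤ b i for all i. There exists a positive integer β₀ with (a i)·β₀ = (b i) + 1 for all i and ∑ i, b i = 2·β₀ + 1 if and only if the multiset of pairs { (a i, b i) : i ∈ Fin k } is one of the following eight multisets: {(3,5)} (then k = 1, β₀ = 2); {(4,3)} (k = 1, β₀ = 1); {(1,2),(2,5)} (k = 2, β₀ = 3); {(2,1),(3,2)} (k = 2, β₀ = 1); {(1,3),(1,3),(1,3)} (k = 3, β₀ = 4); {(1,1),(1,1),(2,3)}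 (k = 3, β₀ = 2); {(2,1),(2,1),(2,1)} (k = 3, β₀ = 1); {(1,1),(1,1),(1,1),(1,1),(1,1)} (k = 5, β₀ = 2). -/
open Finset

/-- The Gorenstein system rephrased for the multiset of pairs `(a i, b i)`. -/
theorem system_iff_multiset {k : ℕ} (a b : Fin k → ℕ) (β : ℕ) :
    ((∀ i, a i * β = b i + 1) ∧ ∑ i, b i = 2 * β + 1) ↔
      (∀ p ∈ Finset.univ.val.map (fun i => (a i, b i)), p.1 * β = p.2 + 1) ∧
        ((Finset.univ.val.map (fun i => (a i, b i))).map Prod.snd).sum = 2 * β + 1 := by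
  simp only [Multiset.map_map, Function.comp_def, Multiset.mem_map, Finset.mem_val, Finset.mem_univ,
    true_and, forall_exists_index, forall_apply_eq_imp_iff, Finset.sum]

/-- Summing the equations `a i * β = b i + 1` bounds the number of factors and `β`. -/
theorem bounds_of_system {k β : ℕ} {a b : Fin k → ℕ} (ha : ∀ i, 1 ≤ a i) (hb : ∀ i, 1 ≤ b i)
    (h : ∀ i, a i * β = b i + 1) (hsum : ∑ i, b i = 2 * β + 1) :
    k ≤ 5 ∧ β ≤ k + 1 ∧ (∑ i, a i) * β = 2 * β + 1 + k := by
  have hA : (∑ i, a i) * β = 2 * β + 1 + k := by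
    rw [Finset.sum_mul, Finset.sum_congr rfl fun i _ => h i, Finset.sum_add_distrib, hsum]
    simp
  have hk : k ≤ ∑ i, a i := by
    simpa using Finset.card_nsmul_le_sum Finset.univ a 1 fun i _ => ha i
  have hkb : k ≤ 2 * β + 1 := by
    simpa [hsum] using Finset.card_nsmul_le_sum Finset.univ b 1 fun i _ => hb i
  have hA3 : 3 ≤ ∑ i, a i := by
    by_contra! hlt
    have := Nat.mul_le_mul_right β (Nat.le_of_lt_succ hlt)
    omega
  refine ⟨?_, ?_, hA⟩
  · by_contra! hk6
    have hβ : 3 ≤ β := by omega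
    nlinarith [Nat.mul_le_mul_right β hk]
  · nlinarith

/-- Diophantine core of the Gorenstein classification: the system
`(a i)·β₀ = b i + 1` for all `i` and `∑ i, b i = 2β₀ + 1` has a positive integer
solution `β₀` iff the multiset `{(a i, b i)}` is one of eight explicit multisets. -/
theorem stmt_11 (k : ℕ) (hk : 1 ≤ k) (a b : Fin k → ℕ)
    (ha : ∀ i, 1 ≤ a i) (hb : ∀ i, 1 ≤ b i) :
    (∃ β₀ : ℕ, 0 < β₀ ∧ (∀ i, a i * β₀ = b i + 1) ∧ ∑ i, b i = 2 * β₀ + 1) ↔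
      (Finset.univ.val.map (fun i => (a i, b i)) = ({(3, 5)} : Multiset (ℕ × ℕ)) ∨
       Finset.univ.val.map (fun i => (a i, b i)) = ({(4, 3)} : Multiset (ℕ × ℕ)) ∨
       Finset.univ.val.map (fun i => (a i, b i)) = ({(1, 2), (2, 5)} : Multiset (ℕ × ℕ)) ∨
       Finset.univ.val.map (fun i => (a i, b i)) = ({(2, 1), (3, 2)} : Multiset (ℕ × ℕ)) ∨
       Finset.univ.val.map (fun i => (a i, b i)) =
         ({(1, 3), (1, 3), (1, 3)} : Multiset (ℕ × ℕ)) ∨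
       Finset.univ.val.map (fun i => (a i, b i)) =
         ({(1, 1), (1, 1), (2, 3)} : Multiset (ℕ × ℕ)) ∨
       Finset.univ.val.map (fun i => (a i, b i)) =
         ({(2, 1), (2, 1), (2, 1)} : Multiset (ℕ × ℕ)) ∨
       Finset.univ.val.map (fun i => (a i, b i)) =
         ({(1, 1), (1, 1), (1, 1), (1, 1), (1, 1)} : Multiset (ℕ × ℕ))) := by
  constructor
  · rintro ⟨β, hβ, h, hsum⟩
    obtain ⟨hk5, hβk, hA⟩ := bounds_of_system ha hb h hsum
    clear hk
    interval_cases k <;> interval_cases β <;>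
      simp [Fin.forall_fin_succ, Fin.univ_succ] at * <;> try omega
    · obtain ⟨h0, h1, h2, h3⟩ | ⟨h0, h1, h2, h3⟩ :
          (a 0 = 2 ∧ b 0 = 1 ∧ a 1 = 3 ∧ b 1 = 2) ∨ (a 0 = 3 ∧ b 0 = 2 ∧ a 1 = 2 ∧ b 1 = 1) := by
        omega
      all_goals rw [h0, h1, h2, h3]; decide
    · obtain ⟨h0, h1, h2, h3⟩ | ⟨h0, h1, h2, h3⟩ :
          (a 0 = 1 ∧ b 0 = 2 ∧ a 1 = 2 ∧ b 1 = 5) ∨ (a 0 = 2 ∧ b 0 = 5 ∧ a 1 = 1 ∧ b 1 = 2) := by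
        omega
      all_goals rw [h0, h1, h2, h3]; decide
    · obtain ⟨h0, h1, h2, h3, h4, h5⟩ :
          a 0 = 2 ∧ b 0 = 1 ∧ a 1 = 2 ∧ b 1 = 1 ∧ a 2 = 2 ∧ b 2 = 1 := by
        omega
      rw [h0, h1, h2, h3, h4, h5]; decide
    · obtain ⟨h0, h1, h2, h3, h4, h5⟩ | ⟨h0, h1, h2, h3, h4, h5⟩ | ⟨h0, h1, h2, h3, h4, h5⟩ :
          (a 0 = 1 ∧ b 0 = 1 ∧ a 1 = 1 ∧ b 1 = 1 ∧ a 2 = 2 ∧ b 2 = 3) ∨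
          (a 0 = 1 ∧ b 0 = 1 ∧ a 1 = 2 ∧ b 1 = 3 ∧ a 2 = 1 ∧ b 2 = 1) ∨
          (a 0 = 2 ∧ b 0 = 3 ∧ a 1 = 1 ∧ b 1 = 1 ∧ a 2 = 1 ∧ b 2 = 1) := by
        omega
      all_goals rw [h0, h1, h2, h3, h4, h5]; decide
    · obtain ⟨h0, h1, h2, h3, h4, h5⟩ :
          a 0 = 1 ∧ b 0 = 3 ∧ a 1 = 1 ∧ b 1 = 3 ∧ a 2 = 1 ∧ b 2 = 3 := by
        omega
      rw [h0, h1, h2, h3, h4, h5]; decide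
    · obtain ⟨h0, h1, h2, h3, h4, h5, h6, h7, h8, h9⟩ :
          a 0 = 1 ∧ b 0 = 1 ∧ a 1 = 1 ∧ b 1 = 1 ∧ a 2 = 1 ∧ b 2 = 1 ∧ a 3 = 1 ∧ b 3 = 1 ∧
            a 4 = 1 ∧ b 4 = 1 := by
        omega
      rw [h0, h1, h2, h3, h4, h5, h6, h7, h8, h9]; decide
  · rintro (h | h | h | h | h | h | h | h)
    · exact ⟨2, by simp, (system_iff_multiset a b 2).2 (by rw [h]; decide)⟩
    · exact ⟨1, by simp, (system_iff_multiset a b 1).2 (by rw [h]; decide)⟩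
    · exact ⟨3, by simp, (system_iff_multiset a b 3).2 (by rw [h]; decide)⟩
    · exact ⟨1, by simp, (system_iff_multiset a b 1).2 (by rw [h]; decide)⟩
    · exact ⟨4, by simp, (system_iff_multiset a b 4).2 (by rw [h]; decide)⟩
    · exact ⟨2, by simp, (system_iff_multiset a b 2).2 (by rw [h]; decide)⟩
    · exact ⟨1, by simp, (system_iff_multiset a b 1).2 (by rw [h]; decide)⟩
    · exact ⟨2, by simp, (system_iff_multiset a b 2).2 (by rw [h]; decide)⟩
end

section
/- Diophantine core of the ℚ-Gorenstein classification (Case with all facets present in the paper's ℚ-Gorenstein theorem): let k ≥ 1, a b : Fin k → ℕ with 1 ≤ a i and 1 ≤ b i for all i. There exists a positive rational number β₀ with (a i : ℚ)·β₀ = (b i : ℚ) + 1 for all i and (∑ i, b i : ℚ) = 2·β₀ + 1 if and only if the multiset of pairs { (a i, b i) : i ∈ Fin k } is one of the following eleven multisets: the eight integer-solution cases {(3,5)}, {(4,3)}, {(1,2),(2,5)}, {(2,1),(3,2)}, {(1,3),(1,3),(1,3)}, {(1,1),(1,1),(2,3)}, {(2,1),(2,1),(2,1)}, {(1,1),(1,1),(1,1),(1,1),(1,1)},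 or one of the three additional cases with non-integral β₀: {(2,2),(2,2)} (then β₀ = 3/2); {(4,1),(4,1)} (β₀ = 1/2); {(6,2)} (β₀ = 1/2). -/
/-- The multisets of at most `f` pairs `(a, b)` with `1 ≤ b`, `a * n = 2 * b + 2` and second
coordinates summing to `N`, listed by choosing one pair after the other. -/
def pairSearch (n : ℕ) : ℕ → ℕ → List (Multiset (ℕ × ℕ))
  | 0, N => if N = 0 then [0] else []
  | f + 1, N => (if N = 0 then [0] else []) ++ (List.range N).flatMap fun j =>
      if n ∣ 2 * (j + 1) + 2 then
        (pairSearch n f (N - (j + 1))).map (((2 * (j + 1) + 2) / n, j + 1) ::ₘ ·)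
      else []

theorem mem_pairSearch {n : ℕ} (hn : 1 ≤ n) (M : Multiset (ℕ × ℕ)) :
    ∀ f : ℕ, M.card ≤ f → (∀ p ∈ M, 1 ≤ p.2 ∧ p.1 * n = 2 * p.2 + 2) →
      M ∈ pairSearch n f (M.map Prod.snd).sum := by
  induction M using Multiset.induction_on with
  | empty => intro f _ _; cases f <;> simp [pairSearch]
  | cons p M ih =>
    intro f hf hM
    obtain ⟨a, b⟩ := p
    obtain ⟨hb, hab⟩ := hM (a, b) (Multiset.mem_cons_self _ _)
    cases f with
    | zero => simp at hf
    | succ f =>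
      have hrec := ih f (by simpa using hf) fun p hp => hM p (Multiset.mem_cons_of_mem hp)
      obtain ⟨j, rfl⟩ : ∃ j, b = j + 1 := ⟨b - 1, by simp at hb; omega⟩
      simp only at hab
      have hdvd : n ∣ 2 * (j + 1) + 2 := ⟨a, by rw [← hab, mul_comm]⟩
      have hdiv : (2 * (j + 1) + 2) / n = a := by
        rw [← hab, Nat.mul_div_cancel _ hn]
      simp only [pairSearch, Multiset.map_cons, Multiset.sum_cons]
      refine List.mem_append_right _ (List.mem_flatMap.2 ⟨j, List.mem_range.2 (by omega), ?_⟩)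
      rw [if_pos hdvd, hdiv, Nat.add_sub_cancel_left]
      exact List.mem_map_of_mem hrec

theorem sum_map_fst_mul {n : ℕ} (M : Multiset (ℕ × ℕ))
    (hM : ∀ p ∈ M, p.1 * n = 2 * p.2 + 2) :
    (M.map Prod.fst).sum * n = 2 * (M.map Prod.snd).sum + 2 * M.card := by
  induction M using Multiset.induction_on with
  | empty => simp
  | cons p M ih =>
    have h := ih fun q hq => hM q (Multiset.mem_cons_of_mem hq)
    have hp := hM p (Multiset.mem_cons_self _ _)
    simp only [Multiset.map_cons, Multiset.sum_cons, Multiset.card_cons, add_mul, h, hp]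
    ring

theorem card_le_sum_map {α : Type*} (g : α → ℕ) (M : Multiset α) (hM : ∀ p ∈ M, 1 ≤ g p) :
    M.card ≤ (M.map g).sum := by
  simpa using Multiset.card_nsmul_le_sum (s := M.map g) (a := 1) (by simpa using hM)

theorem le_eight_of_sum_eq {n : ℕ} {M : Multiset (ℕ × ℕ)}
    (hM : ∀ p ∈ M, 1 ≤ p.2 ∧ p.1 * n = 2 * p.2 + 2) (hsum : (M.map Prod.snd).sum = n + 1) :
    n ≤ 8 := by
  have hS := sum_map_fst_mul M fun p hp => (hM p hp).2
  have hk : M.card ≤ (M.map Prod.fst).sum := card_le_sum_map _ M fun p hp =>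
    Nat.one_le_iff_ne_zero.2 fun h => by simpa [h] using (hM p hp).2
  have h0 : M.card ≠ 0 := fun h => by simp [Multiset.card_eq_zero.1 h] at hsum
  rw [hsum] at hS
  generalize (M.map Prod.fst).sum = S at hS hk
  generalize M.card = k at hS hk h0
  by_contra! hn
  rcases Nat.lt_or_ge S 3 with h | h
  · interval_cases S <;> omega
  · have h1 : 9 * (S - 2) ≤ n * (S - 2) := Nat.mul_le_mul_right _ hn
    obtain ⟨s, rfl⟩ := Nat.exists_eq_add_of_le h
    have h2 : 3 + s - 2 = s + 1 := by omega
    rw [h2] at h1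
    nlinarith

theorem classification_of_sum_eq {n : ℕ} (hn : 1 ≤ n) {M : Multiset (ℕ × ℕ)}
    (hM : ∀ p ∈ M, 1 ≤ p.2 ∧ p.1 * n = 2 * p.2 + 2) (hsum : (M.map Prod.snd).sum = n + 1) :
    M = ({(3, 5)} : Multiset (ℕ × ℕ)) ∨
    M = ({(4, 3)} : Multiset (ℕ × ℕ)) ∨
    M = ({(1, 2), (2, 5)} : Multiset (ℕ × ℕ)) ∨
    M = ({(2, 1), (3, 2)} : Multiset (ℕ × ℕ)) ∨
    M = ({(1, 3), (1, 3), (1, 3)} : Multiset (ℕ × ℕ)) ∨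
    M = ({(1, 1), (1, 1), (2, 3)} : Multiset (ℕ × ℕ)) ∨
    M = ({(2, 1), (2, 1), (2, 1)} : Multiset (ℕ × ℕ)) ∨
    M = ({(1, 1), (1, 1), (1, 1), (1, 1), (1, 1)} : Multiset (ℕ × ℕ)) ∨
    M = ({(2, 2), (2, 2)} : Multiset (ℕ × ℕ)) ∨
    M = ({(4, 1), (4, 1)} : Multiset (ℕ × ℕ)) ∨
    M = ({(6, 2)} : Multiset (ℕ × ℕ)) := by
  have h8 := le_eight_of_sum_eq hM hsum
  have hcard : M.card ≤ n + 1 := hsum ▸ card_le_sum_map _ M fun p hp => (hM p hp).1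
  have hmem := mem_pairSearch hn M (n + 1) hcard hM
  rw [hsum] at hmem
  clear hM hsum hcard
  revert M
  interval_cases n <;> decide

/-- Diophantine core of the ℚ-Gorenstein classification: the system
`(a i)·β₀ = b i + 1` for all `i` and `∑ i, b i = 2β₀ + 1` has a positive rational
solution `β₀` iff the multiset `{(a i, b i)}` is one of eleven explicit multisets. -/
theorem stmt_12 (k : ℕ) (hk : 1 ≤ k) (a b : Fin k → ℕ)
    (ha : ∀ i, 1 ≤ a i) (hb : ∀ i, 1 ≤ b i) :
    (∃ β₀ : ℚ, 0 < β₀ ∧ (∀ i, (a i : ℚ) * β₀ = (b i : ℚ) + 1) ∧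
        ((∑ i, b i : ℕ) : ℚ) = 2 * β₀ + 1) ↔
      (Finset.univ.val.map (fun i => (a i, b i)) = ({(3, 5)} : Multiset (ℕ × ℕ)) ∨
       Finset.univ.val.map (fun i => (a i, b i)) = ({(4, 3)} : Multiset (ℕ × ℕ)) ∨
       Finset.univ.val.map (fun i => (a i, b i)) = ({(1, 2), (2, 5)} : Multiset (ℕ × ℕ)) ∨
       Finset.univ.val.map (fun i => (a i, b i)) = ({(2, 1), (3, 2)} : Multiset (ℕ × ℕ)) ∨
       Finset.univ.val.map (fun i => (a i, b i)) =
         ({(1, 3), (1, 3), (1, 3)} : Multiset (ℕ × ℕ)) ∨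
       Finset.univ.val.map (fun i => (a i, b i)) =
         ({(1, 1), (1, 1), (2, 3)} : Multiset (ℕ × ℕ)) ∨
       Finset.univ.val.map (fun i => (a i, b i)) =
         ({(2, 1), (2, 1), (2, 1)} : Multiset (ℕ × ℕ)) ∨
       Finset.univ.val.map (fun i => (a i, b i)) =
         ({(1, 1), (1, 1), (1, 1), (1, 1), (1, 1)} : Multiset (ℕ × ℕ)) ∨
       Finset.univ.val.map (fun i => (a i, b i)) =
         ({(2, 2), (2, 2)} : Multiset (ℕ × ℕ)) ∨
       Finset.univ.val.map (fun i => (a i, b i)) =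
         ({(4, 1), (4, 1)} : Multiset (ℕ × ℕ)) ∨
       Finset.univ.val.map (fun i => (a i, b i)) = ({(6, 2)} : Multiset (ℕ × ℕ))) := by
  have hsum : ∑ i, b i = ((Finset.univ.val.map fun i => (a i, b i)).map Prod.snd).sum := by
    rw [Multiset.map_map]; rfl
  constructor
  · rintro ⟨β, hβ, hab, hβsum⟩
    have hpos : 1 < ∑ i, b i := by
      have : (1 : ℚ) < (∑ i, b i : ℕ) := by linarith
      exact_mod_cast this
    obtain ⟨n, hn⟩ : ∃ n, ∑ i, b i = n + 1 := ⟨∑ i, b i - 1, by omega⟩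
    rw [hn] at hβsum
    push_cast at hβsum
    have hnβ : (n : ℚ) = 2 * β := by linarith
    refine classification_of_sum_eq (n := n) (by omega) ?_ (hsum ▸ hn)
    simp only [Multiset.mem_map, forall_exists_index, and_imp]
    rintro _ i - rfl
    refine ⟨hb i, ?_⟩
    have : (a i : ℚ) * n = 2 * b i + 2 := by rw [hnβ]; linarith [hab i]
    exact_mod_cast this
  · have hmem : ∀ i, (a i, b i) ∈ Finset.univ.val.map fun i => (a i, b i) := fun i =>
      Multiset.mem_map_of_mem _ (Finset.mem_univ_val i)
    rw [hsum]
    generalize Finset.univ.val.map (fun i => (a i, b i)) = M at hmem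
    intro h
    suffices (∃ β : ℚ, 0 < β ∧ (∀ p ∈ M, (p.1 : ℚ) * β = p.2 + 1) ∧
        ((M.map Prod.snd).sum : ℚ) = 2 * β + 1) from
      let ⟨β, hβ, hp, hs⟩ := this
      ⟨β, hβ, fun i => hp _ (hmem i), hs⟩
    clear hsum hmem
    rcases h with rfl | rfl | rfl | rfl | rfl | rfl | rfl | rfl | rfl | rfl | rfl
    · exact ⟨2, by norm_num, by norm_num, by norm_num⟩
    · exact ⟨1, by norm_num, by norm_num, by norm_num⟩
    · exact ⟨3, by norm_num, by norm_num, by norm_num⟩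
    · exact ⟨1, by norm_num, by norm_num, by norm_num⟩
    · exact ⟨4, by norm_num, by norm_num, by norm_num⟩
    · exact ⟨2, by norm_num, by norm_num, by norm_num⟩
    · exact ⟨1, by norm_num, by norm_num, by norm_num⟩
    · exact ⟨2, by norm_num, by norm_num, by norm_num⟩
    · exact ⟨3 / 2, by norm_num, by norm_num, by norm_num⟩
    · exact ⟨1 / 2, by norm_num, by norm_num, by norm_num⟩
    · exact ⟨1 / 2, by norm_num, by norm_num, by norm_num⟩
end

section
/- Coordinate form of the paper's main structure theorem (the secant variety of a simplicial toric embedding is the product of an affine space and the cone over the toric variety T_Δ): in the space (Fin n → ℂ) × ((σ : Δ₂) → ℂ) with its standard topology, the closure of the set A = { (z, Z) | ∃ π ∈ ℂ, ∃ t u : Fin n → ℂ, (∀ j, z j = π·(t j) + (1−π)·(u j)) ∧ (∀ σ ∈ Δ₂, Z σ = π·(1−π)·(1−2π)^{card σ − 2} · ∏_{v ∈ σ} (t (ℓ v) − u (ℓ v))) } equals the product Set.univ ×ˢ closure B, where B = { Z | ∃ λ ∈ ℂ, ∃ w : Fin n → ℂ, ∀ σ ∈ Δ₂, Z σ = λ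 · ∏_{v ∈ σ} w (ℓ v) }. (Here A is the image of the parameterization of the secant variety σ₂(V_Δ) written in simplicial cumulant coordinates, and closure B is the affine cone over the toric variety T_Δ; the equality says σ₂(V_Δ) ≅ ℂⁿ × \widehat{T}_Δ.) -/
open Finset

/-- The value at `a` of a continuous function lies in the closure of any set containing all
its other values. -/
theorem mem_closure_of_forall_ne {X : Type*} [TopologicalSpace X] {S : Set X} {f : ℂ → X}
    (hf : Continuous f) (a : ℂ) (h : ∀ x, x ≠ a → f x ∈ S) (x : ℂ) : f x ∈ closure S :=
  map_mem_closure hf (dense_compl_singleton a x) fun y hy => h y hy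

theorem mul_pow_mul_prod_eq {V : Type*} {σ : Finset V} (hσ : 2 ≤ σ.card) {c : ℂ} (hc : c ≠ 0)
    (a : ℂ) (d : V → ℂ) :
    a * c ^ (σ.card - 2) * ∏ v ∈ σ, d v = a / c ^ 2 * ∏ v ∈ σ, c * d v := by
  obtain ⟨k, hk⟩ := Nat.exists_eq_add_of_le hσ
  rw [Finset.prod_mul_distrib, Finset.prod_const, hk, Nat.add_sub_cancel_left, pow_add]
  field_simp

/-- Away from `-1/4`, every complex number is of the form `π (1 - π) / (1 - 2 π) ^ 2`. -/
theorem exists_mul_one_sub_div_sq_eq {a : ℂ} (ha : a ≠ -1 / 4) :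
    ∃ p : ℂ, 1 - 2 * p ≠ 0 ∧ p * (1 - p) / (1 - 2 * p) ^ 2 = a := by
  have ha' : 1 + 4 * a ≠ 0 := fun h => ha (by linear_combination h / 4)
  obtain ⟨c, hc⟩ := IsAlgClosed.exists_pow_nat_eq (1 + 4 * a)⁻¹ two_pos
  have hc0 : c ≠ 0 := by
    rintro rfl
    exact inv_ne_zero ha' (by simpa using hc.symm)
  have hp : 1 - 2 * ((1 - c) / 2) = c := by ring
  refine ⟨(1 - c) / 2, by rwa [hp], ?_⟩
  rw [hp, div_eq_iff (pow_ne_zero 2 hc0)]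
  have h1 : (1 + 4 * a) * c ^ 2 = 1 := by rw [hc, mul_inv_cancel₀ ha']
  linear_combination -h1 / 4

/-- Coordinate form of the main structure theorem: in simplicial cumulant coordinates,
the closure of the image of the parameterization of the secant variety of the
simplicial toric embedding equals the product of the affine space `ℂⁿ` and the affine
cone over the toric variety `T_Δ`. -/
theorem stmt_16 (V : Type*) [Fintype V] [DecidableEq V] (n : ℕ) (hn : 1 ≤ n)
    (ℓ : V → Fin n) (Δ : Set (Finset V))
    (hdown : ∀ σ ∈ Δ, ∀ τ ⊆ σ, τ ∈ Δ)
    (hsingle : ∀ v : V, ({v} : Finset V) ∈ Δ)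
    (A : Set ((Fin n → ℂ) × ({σ : Finset V // σ ∈ Δ ∧ 2 ≤ σ.card} → ℂ)))
    (hA : A = {zZ | ∃ π : ℂ, ∃ t u : Fin n → ℂ,
      (∀ j, zZ.1 j = π * t j + (1 - π) * u j) ∧
      (∀ σ : {σ : Finset V // σ ∈ Δ ∧ 2 ≤ σ.card},
        zZ.2 σ = π * (1 - π) * (1 - 2 * π) ^ (σ.1.card - 2) *
          ∏ v ∈ σ.1, (t (ℓ v) - u (ℓ v)))})
    (B : Set ({σ : Finset V // σ ∈ Δ ∧ 2 ≤ σ.card} → ℂ))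
    (hB : B = {Z | ∃ lam : ℂ, ∃ w : Fin n → ℂ,
      ∀ σ : {σ : Finset V // σ ∈ Δ ∧ 2 ≤ σ.card},
        Z σ = lam * ∏ v ∈ σ.1, w (ℓ v)}) :
    closure A = (Set.univ : Set (Fin n → ℂ)) ×ˢ closure B := by
  subst hA hB
  apply subset_antisymm
  · refine closure_minimal ?_ (isClosed_univ.prod isClosed_closure)
    rintro ⟨z, Z⟩ ⟨p, t, u, -, hZ⟩
    refine ⟨trivial, ?_⟩
    obtain rfl : Z = _ := funext hZ
    refine mem_closure_of_forall_ne
      (f := fun p (σ : {σ : Finset V // σ ∈ Δ ∧ 2 ≤ σ.card}) =>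
        p * (1 - p) * (1 - 2 * p) ^ (σ.1.card - 2) *
        ∏ v ∈ σ.1, (t (ℓ v) - u (ℓ v))) (by fun_prop) (1 / 2) (fun q hq => ?_) p
    have hc : 1 - 2 * q ≠ 0 := fun h => hq (by linear_combination -h / 2)
    exact ⟨q * (1 - q) / (1 - 2 * q) ^ 2, fun j => (1 - 2 * q) * (t j - u j),
      fun σ => mul_pow_mul_prod_eq σ.2.2 hc _ _⟩
  · rw [← closure_univ, ← closure_prod_eq]
    refine closure_minimal ?_ isClosed_closure
    rintro ⟨z, Z⟩ ⟨-, lam, w, hZ⟩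
    obtain rfl : Z = _ := funext hZ
    refine mem_closure_of_forall_ne
      (f := fun a => (z, fun σ : {σ : Finset V // σ ∈ Δ ∧ 2 ≤ σ.card} =>
        a * ∏ v ∈ σ.1, w (ℓ v))) (by fun_prop) (-1 / 4)
      (fun a ha => ?_) lam
    obtain ⟨p, hc, rfl⟩ := exists_mul_one_sub_div_sq_eq ha
    refine ⟨p, fun j => z j + (1 - p) * (w j / (1 - 2 * p)),
      fun j => z j - p * (w j / (1 - 2 * p)), fun j => by ring, fun σ => ?_⟩
    rw [mul_pow_mul_prod_eq σ.2.2 hc]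
    have hd : ∀ x y : ℂ, x = (1 - 2 * p) *
        (y + (1 - p) * (x / (1 - 2 * p)) - (y - p * (x / (1 - 2 * p)))) := fun x y => by
      field_simp
      ring
    simp only [← hd]
end
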